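/- arXiv:2111.14432 — 2 statements merged into one kernel-verified Lean document; each statement's English description precedes it below -/
import Mathlib

section
/- IF_n = ⟨J⟩, i.e. every element of IF_n is a finite product of elements of IF_n of rank at least n − 2. -/
/-!
Common framework: partial injections on `X_n = {1, …, n}`, the fence order,
fence-preserving partial injections, the semigroups `PFI_n`, `IF_n`,
the set `J` of elements of rank at least `n - 2`, and (for even `n`)
the generating system `G`.
-/

namespace FencePaper

/-- The fence (zigzag) order on `{1, …, n}`: `a <_f b` iff `|a - b| = 1` and `b` is even. -/
def fenceLt (a b : ℕ) : Prop := (a + 1 = b ∨ b + 1 = a) ∧ Even b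

/-- A partial injection of `X_n = {1, …, n}`, given by its graph. -/
structure PartialInj (n : ℕ) where
  graph : Set (ℕ × ℕ)
  mem_le : ∀ p ∈ graph, 1 ≤ p.1 ∧ p.1 ≤ n ∧ 1 ≤ p.2 ∧ p.2 ≤ n
  functional : ∀ p ∈ graph, ∀ q ∈ graph, p.1 = q.1 → p.2 = q.2
  injOn : ∀ p ∈ graph, ∀ q ∈ graph, p.2 = q.2 → p.1 = q.1

namespace PartialInj

variable {n : ℕ}

theorem ext' {α β : PartialInj n} (h : α.graph = β.graph) : α = β := by
  cases α
  cases β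
  simp only at h
  subst h
  rfl

/-- The domain of a partial injection. -/
def dom (α : PartialInj n) : Set ℕ := {x | ∃ y, (x, y) ∈ α.graph}

/-- The image (range) of a partial injection. -/
def im (α : PartialInj n) : Set ℕ := {y | ∃ x, (x, y) ∈ α.graph}

/-- The rank of a partial injection: the cardinality of its image. -/
noncomputable def rank (α : PartialInj n) : ℕ := α.im.ncard

/-- The inverse partial injection. -/
def inv (α : PartialInj n) : PartialInj n where
  graph := {p | (p.2, p.1) ∈ α.graph}
  mem_le := by
    rintro p hp
    obtain ⟨h1, h2, h3, h4⟩ := α.mem_le _ hp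
    exact ⟨h3, h4, h1, h2⟩
  functional := by
    rintro p hp q hq h
    exact α.injOn _ hp _ hq h
  injOn := by
    rintro p hp q hq h
    exact α.functional _ hp _ hq h

/-- Composition: first `α`, then `β` (maps act on the right). -/
def comp (α β : PartialInj n) : PartialInj n where
  graph := {p | ∃ y, (p.1, y) ∈ α.graph ∧ (y, p.2) ∈ β.graph}
  mem_le := by
    rintro p ⟨y, h1, h2⟩
    obtain ⟨a, b, -, -⟩ := α.mem_le _ h1
    obtain ⟨-, -, c, d⟩ := β.mem_le _ h2
    exact ⟨a, b, c, d⟩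
  functional := by
    rintro p ⟨y, h1, h2⟩ q ⟨z, h3, h4⟩ h
    have hyz : y = z := α.functional _ h1 _ h3 h
    subst hyz
    exact β.functional (y, p.2) h2 (y, q.2) h4 rfl
  injOn := by
    rintro p ⟨y, h1, h2⟩ q ⟨z, h3, h4⟩ h
    have hyz : y = z := β.injOn _ h2 _ h4 h
    subst hyz
    exact α.injOn (p.1, y) h1 (q.1, y) h3 rfl

/-- The partial identity map on `D ∩ {1, …, n}`. -/
def pid (n : ℕ) (D : Set ℕ) : PartialInj n where
  graph := {p | p.1 ∈ Set.Icc 1 n ∧ p.1 ∈ D ∧ p.2 = p.1}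
  mem_le := by
    rintro p ⟨⟨h1, h2⟩, -, h3⟩
    refine ⟨h1, h2, ?_, ?_⟩ <;> omega
  functional := by
    rintro p ⟨-, -, h1⟩ q ⟨-, -, h2⟩ h
    rw [h1, h2, h]
  injOn := by
    rintro p ⟨-, -, h1⟩ q ⟨-, -, h2⟩ h
    rw [← h1, ← h2, h]

instance : Monoid (PartialInj n) where
  mul := comp
  one := pid n (Set.Icc 1 n)
  mul_assoc a b c := by
    apply ext'
    ext q
    constructor
    · rintro ⟨y, ⟨z, h1, h2⟩, h3⟩
      exact ⟨z, h1, y, h2, h3⟩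
    · rintro ⟨z, h1, y, h2, h3⟩
      exact ⟨y, ⟨z, h1, h2⟩, h3⟩
  one_mul a := by
    apply ext'
    ext q
    constructor
    · rintro ⟨y, ⟨-, -, h⟩, h2⟩
      have hy : y = q.1 := h
      rw [hy] at h2
      exact h2
    · intro hq
      obtain ⟨h1, h2, -, -⟩ := a.mem_le _ hq
      exact ⟨q.1, ⟨⟨h1, h2⟩, ⟨h1, h2⟩, rfl⟩, hq⟩
  mul_one a := by
    apply ext'
    ext q
    constructor
    · rintro ⟨y, h1, ⟨-, -, h⟩⟩
      have hy : q.2 = y := h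
      rw [← hy] at h1
      exact h1
    · intro hq
      obtain ⟨-, -, h3, h4⟩ := a.mem_le _ hq
      exact ⟨q.2, hq, ⟨h3, h4⟩, ⟨h3, h4⟩, rfl⟩

theorem mul_graph (α β : PartialInj n) :
    (α * β).graph = {p | ∃ y, (p.1, y) ∈ α.graph ∧ (y, p.2) ∈ β.graph} := rfl

/-- `α` is fence-preserving. -/
def FP (α : PartialInj n) : Prop :=
  ∀ p ∈ α.graph, ∀ q ∈ α.graph, fenceLt p.1 q.1 → fenceLt p.2 q.2

/-- The image of a subset under a partial injection. -/
def imageOf (α : PartialInj n) (S : Set ℕ) : Set ℕ := {y | ∃ x ∈ S, (x, y) ∈ α.graph}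

end PartialInj

open PartialInj

/-- `PFI_n`: the semigroup of all fence-preserving partial injections. -/
def PFIset (n : ℕ) : Set (PartialInj n) := {α | α.FP}

/-- `IF_n = {α ∈ PFI_n : α⁻¹ ∈ PFI_n}`. -/
def IFset (n : ℕ) : Set (PartialInj n) := {α | α.FP ∧ α.inv.FP}

/-- `J = {α ∈ IF_n : rank α ≥ n - 2}`. -/
def Jset (n : ℕ) : Set (PartialInj n) := {α | α ∈ IFset n ∧ n - 2 ≤ α.rank}

/-- `A` is a maximal block of consecutive integers of `D ⊆ {1, …, n}`. -/
def IsBlock (n : ℕ) (D A : Set ℕ) : Prop :=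
  ∃ i r : ℕ, 1 ≤ i ∧ A = Set.Icc i (i + r) ∧ A ⊆ D ∧
    (i = 1 ∨ i - 1 ∉ D) ∧ (i + r = n ∨ i + r + 1 ∉ D)

/-- `α(k)`: the maximal blocks of `dom α` of cardinality `k`. -/
def blockSet {n : ℕ} (α : PartialInj n) (k : ℕ) : Set (Set ℕ) :=
  {A | IsBlock n α.dom A ∧ A.ncard = k}

/-- `α°(2k+1)`: the maximal blocks `{i, …, i+2k}` of `dom α` with `i` odd. -/
def oddBlockSet {n : ℕ} (α : PartialInj n) (k : ℕ) : Set (Set ℕ) :=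
  {A | A ∈ blockSet α (2 * k + 1) ∧ Odd (sInf A)}

/-- The graph of `σ₁`: domain `X_n ∖ {2}`, `1 ↦ n`, `x ↦ x - 2` for `3 ≤ x ≤ n`. -/
def sigma1Graph (n : ℕ) : Set (ℕ × ℕ) :=
  {q | 1 ≤ q.1 ∧ q.1 ≤ n ∧ q.1 ≠ 2 ∧ q.2 = if q.1 = 1 then n else q.1 - 2}

/-- The graph of `σ₂ = σ₁⁻¹`: domain `X_n ∖ {n-1}`, `x ↦ x + 2` for `x ≤ n - 2`, `n ↦ 1`. -/
def sigma2Graph (n : ℕ) : Set (ℕ × ℕ) :=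
  {q | 1 ≤ q.1 ∧ q.1 ≤ n ∧ q.1 ≠ n - 1 ∧ q.2 = if q.1 = n then 1 else q.1 + 2}

/-- The graph of `γ_i`: domain `X_n ∖ {i}`, `x ↦ i - x` for `x < i`, `x ↦ x` for `x > i`. -/
def gammaGraph (n i : ℕ) : Set (ℕ × ℕ) :=
  {q | 1 ≤ q.1 ∧ q.1 ≤ n ∧ q.1 ≠ i ∧ q.2 = if q.1 < i then i - q.1 else q.1}

/-- The graph of `δ_i`: domain `X_n ∖ {i}`, `x ↦ x` for `x < i`, `x ↦ n + i + 1 - x` for `x > i`. -/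
def deltaGraph (n i : ℕ) : Set (ℕ × ℕ) :=
  {q | 1 ≤ q.1 ∧ q.1 ≤ n ∧ q.1 ≠ i ∧ q.2 = if q.1 < i then q.1 else n + i + 1 - q.1}

/-- The graph of `β_{i,j}`: domain `X_n ∖ {i, j}`, reversing the interval strictly
between `i` and `j` and fixing everything else. -/
def betaGraph (n i j : ℕ) : Set (ℕ × ℕ) :=
  {q | 1 ≤ q.1 ∧ q.1 ≤ n ∧ q.1 ≠ i ∧ q.1 ≠ j ∧
    q.2 = if i < q.1 ∧ q.1 < j then i + j - q.1 else q.1}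

/-- The generating system `G` (for even `n`), given elements `σ₁, σ₂` and families
`γ, δ` realizing the prescribed graphs. -/
def Gset (n : ℕ) (σ₁ σ₂ : PartialInj n) (γ δ : ℕ → PartialInj n) : Set (PartialInj n) :=
  {pid n (Set.Icc 1 n), σ₁, σ₂} ∪
    {g | ∃ i, Even i ∧ 4 ≤ i ∧ i ≤ n ∧ g = γ i} ∪
    {g | ∃ i, Odd i ∧ i ≤ n - 3 ∧ g = δ i}

theorem fenceLt_iff (a b : ℕ) : fenceLt a b ↔ (a + 1 = b ∨ b + 1 = a) ∧ b % 2 = 0 := by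
  rw [fenceLt, Nat.even_iff]

namespace PartialInj

variable {n : ℕ} {α β : PartialInj n}

theorem mem_mul {x z : ℕ} :
    (x, z) ∈ (α * β).graph ↔ ∃ y, (x, y) ∈ α.graph ∧ (y, z) ∈ β.graph := Iff.rfl

theorem mem_inv {x y : ℕ} : (x, y) ∈ α.inv.graph ↔ (y, x) ∈ α.graph := Iff.rfl

theorem inv_mul_eq (α β : PartialInj n) : (α * β).inv = β.inv * α.inv := by
  apply ext'
  ext ⟨x, z⟩
  simp only [mem_inv, mem_mul]
  exact exists_congr fun _ => and_comm

theorem bounds {x y : ℕ} (h : (x, y) ∈ α.graph) : 1 ≤ x ∧ x ≤ n ∧ 1 ≤ y ∧ y ≤ n :=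
  α.mem_le _ h

theorem eq_right {x y z : ℕ} (h : (x, y) ∈ α.graph) (h' : (x, z) ∈ α.graph) : y = z :=
  α.functional _ h _ h' rfl

theorem eq_left {x y z : ℕ} (h : (x, z) ∈ α.graph) (h' : (y, z) ∈ α.graph) : x = y :=
  α.injOn _ h _ h' rfl

theorem rank_inv (α : PartialInj n) : α.inv.rank = α.rank := by
  have h : ∀ x ∈ α.inv.im, ∃ y, (x, y) ∈ α.graph := fun x hx => hx
  choose! f hf using h
  refine Set.ncard_congr (fun x _ => f x) (fun x hx => ⟨x, hf x hx⟩) ?_ ?_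
  · intro x y hx hy hxy
    have h1 := hf x hx
    rw [show f x = f y from hxy] at h1
    exact eq_left h1 (hf y hy)
  · rintro y ⟨x, hx⟩
    exact ⟨x, ⟨y, hx⟩, eq_right (hf x ⟨y, hx⟩) hx⟩

/-- The restriction of an injective function to a set, as a partial injection. -/
def ofFun (n : ℕ) (f : ℕ → ℕ) (D : Set ℕ) (hD : ∀ x ∈ D, 1 ≤ x ∧ x ≤ n ∧ 1 ≤ f x ∧ f x ≤ n)
    (hf : Set.InjOn f D) : PartialInj n where
  graph := {p | p.1 ∈ D ∧ p.2 = f p.1}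
  mem_le := by
    rintro ⟨x, y⟩ ⟨hx, hy : y = f x⟩
    rw [hy]
    exact hD x hx
  functional := by
    rintro p ⟨-, hp⟩ q ⟨-, hq⟩ h
    rw [hp, hq, h]
  injOn := by
    rintro p ⟨hp, hp'⟩ q ⟨hq, hq'⟩ h
    exact hf hp hq (by rw [← hp', ← hq', h])

theorem mul_inv_cancel_right_of_im_subset (h : α.im ⊆ β.dom) : α * β * β.inv = α := by
  apply ext'
  ext ⟨x, z⟩
  simp only [mem_mul, mem_inv]
  constructor
  · rintro ⟨y, ⟨w, hxw, hwy⟩, hzy⟩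
    rwa [eq_left hzy hwy]
  · intro hxz
    obtain ⟨y, hy⟩ := h ⟨x, hxz⟩
    exact ⟨y, ⟨z, hxz, hy⟩, hy⟩

end PartialInj

variable {n : ℕ} {α β : PartialInj n}

theorem mem_IFset_iff : α ∈ IFset n ↔ ∀ x y x' y', (x, y) ∈ α.graph → (x', y') ∈ α.graph →
    (fenceLt x x' ↔ fenceLt y y') := by
  constructor
  · rintro ⟨h1, h2⟩ x y x' y' h h'
    exact ⟨h1 _ h _ h', h2 (y, x) h (y', x') h'⟩
  · intro h
    exact ⟨fun p hp q hq => (h _ _ _ _ hp hq).1, fun p hp q hq => (h _ _ _ _ hp hq).2⟩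

theorem inv_mem_IFset (h : α ∈ IFset n) : α.inv ∈ IFset n := ⟨h.2, h.1⟩

theorem mul_mem_IFset (hα : α ∈ IFset n) (hβ : β ∈ IFset n) : α * β ∈ IFset n := by
  rw [mem_IFset_iff] at *
  rintro x z x' z' ⟨y, h1, h2⟩ ⟨y', h1', h2'⟩
  exact (hα _ _ _ _ h1 h1').trans (hβ _ _ _ _ h2 h2')

theorem inv_mem_Jset (h : α ∈ Jset n) : α.inv ∈ Jset n :=
  ⟨inv_mem_IFset h.1, (rank_inv α).symm ▸ h.2⟩

theorem inv_mem_closure (h : α ∈ Subsemigroup.closure (Jset n)) :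
    α.inv ∈ Subsemigroup.closure (Jset n) := by
  induction h using Subsemigroup.closure_induction with
  | mem x hx => exact Subsemigroup.subset_closure (inv_mem_Jset hx)
  | mul x y _ _ hx hy =>
    rw [inv_mul_eq]
    exact mul_mem hy hx

theorem mem_closure_of_inv (h : α.inv ∈ Subsemigroup.closure (Jset n)) :
    α ∈ Subsemigroup.closure (Jset n) :=
  inv_mem_closure h

theorem closure_subset_IFset : (Subsemigroup.closure (Jset n) : Set (PartialInj n)) ⊆ IFset n := by
  intro α h
  induction h using Subsemigroup.closure_induction with
  | mem x hx => exact hx.1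
  | mul x y _ _ hx hy => exact mul_mem_IFset hx hy

/-- `{1, …, n}` with two (possibly absent) points removed. -/
def puncture (n i j : ℕ) : Set ℕ := {x | 1 ≤ x ∧ x ≤ n ∧ x ≠ i ∧ x ≠ j}

theorem le_ncard_puncture (n i j : ℕ) : n - 2 ≤ (puncture n i j).ncard := by
  have h : puncture n i j = ↑(((Finset.Icc 1 n).erase i).erase j) := by
    ext x
    simp only [puncture, Set.mem_ofPred_eq, Finset.coe_erase, Finset.coe_Icc, Set.mem_sdiff,
      Set.mem_Icc, Set.mem_singleton_iff]
    tauto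
  rw [h, Set.ncard_coe_finset]
  have h1 := Finset.pred_card_le_card_erase (s := Finset.Icc 1 n) (a := i)
  have h2 := Finset.pred_card_le_card_erase (s := (Finset.Icc 1 n).erase i) (a := j)
  rw [Nat.card_Icc] at h1
  omega

theorem exists_mem_Jset_of_puncture (n : ℕ) (f : ℕ → ℕ) (i j : ℕ)
    (hD : ∀ x ∈ puncture n i j, 1 ≤ f x ∧ f x ≤ n) (hf : Set.InjOn f (puncture n i j))
    (hfence : ∀ x ∈ puncture n i j, ∀ y ∈ puncture n i j,
      (fenceLt x y ↔ fenceLt (f x) (f y))) :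
    ∃ μ ∈ Jset n, ∀ x y, (x, y) ∈ μ.graph ↔ x ∈ puncture n i j ∧ y = f x := by
  refine ⟨ofFun n f _ (fun x hx => ⟨hx.1, hx.2.1, hD x hx⟩) hf, ⟨?_, ?_⟩, fun _ _ => Iff.rfl⟩
  · rw [mem_IFset_iff]
    rintro x y x' y' ⟨hx, hy : y = f x⟩ ⟨hx', hy' : y' = f x'⟩
    rw [hy, hy']
    exact hfence x hx x' hx'
  · rw [← rank_inv]
    refine (le_ncard_puncture n i j).trans (le_of_eq ?_)
    rw [rank]
    congr 1
    ext x
    exact ⟨fun hx => ⟨f x, hx, rfl⟩, fun ⟨y, hx, _⟩ => hx⟩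

theorem mem_closure_of_mul_Jset {μ : PartialInj n} (hμ : μ ∈ Jset n) (him : α.im ⊆ μ.dom)
    (h : α * μ ∈ Subsemigroup.closure (Jset n)) : α ∈ Subsemigroup.closure (Jset n) := by
  rw [← mul_inv_cancel_right_of_im_subset him]
  exact mul_mem h (Subsemigroup.subset_closure (inv_mem_Jset hμ))

/-- It suffices to generate the composition of `α` with the reversal of an interval `(i, j)` with
`i + j` even whose end points lie outside the image of `α`. -/
theorem mem_closure_of_reversal (hα : α ∈ IFset n) {i j : ℕ} (hj : j ≤ n + 1)
    (hpar : (i + j) % 2 = 0) (hi : i ∉ α.im) (hj' : j ∉ α.im)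
    (h : ∀ β ∈ IFset n, (∀ x z, (x, z) ∈ β.graph ↔
      ∃ y, (x, y) ∈ α.graph ∧ z = if i < y ∧ y < j then i + j - y else y) →
      β ∈ Subsemigroup.closure (Jset n)) : α ∈ Subsemigroup.closure (Jset n) := by
  obtain ⟨μ, hμ, hg⟩ := exists_mem_Jset_of_puncture n
    (fun y => if i < y ∧ y < j then i + j - y else y) i j
    (by
      rintro x ⟨h1, h2, h3, h4⟩
      split_ifs <;> omega)
    (by
      rintro x ⟨h1, h2, h3, h4⟩ y ⟨h5, h6, h7, h8⟩ hxy
      dsimp only at hxy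
      split_ifs at hxy <;> omega)
    (by
      rintro x ⟨h1, h2, h3, h4⟩ y ⟨h5, h6, h7, h8⟩
      simp only [fenceLt_iff]
      split_ifs <;> omega)
  have key : ∀ x y, (x, y) ∈ α.graph → y ∈ puncture n i j := by
    intro x y hxy
    obtain ⟨-, -, h1, h2⟩ := bounds hxy
    exact ⟨h1, h2, fun h => hi (h ▸ ⟨x, hxy⟩), fun h => hj' (h ▸ ⟨x, hxy⟩)⟩
  refine mem_closure_of_mul_Jset hμ ?_ (h _ (mul_mem_IFset hα hμ.1) ?_)
  · rintro y ⟨x, hxy⟩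
    exact ⟨_, (hg _ _).2 ⟨key x y hxy, rfl⟩⟩
  · intro x z
    simp only [mem_mul, hg]
    exact ⟨fun ⟨y, h1, h2⟩ => ⟨y, h1, h2.2⟩, fun ⟨y, h1, h2⟩ => ⟨y, h1, key x y h1, h2⟩⟩

/-- The element of `J` moving the point `p` to `1` and shifting the points below `p - 1`. -/
theorem exists_mem_Jset_moveFront {p : ℕ} (hp : 1 ≤ p) (hpn : p ≤ n) :
    ∃ μ ∈ Jset n, ∀ x y, (x, y) ∈ μ.graph ↔ x ∈ puncture n (p - 1) (p + 1) ∧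
      y = if x = p then 1 else if x < p then x + 2 else x := by
  refine exists_mem_Jset_of_puncture n
    (fun x => if x = p then 1 else if x < p then x + 2 else x) (p - 1) (p + 1) ?_ ?_ ?_
  · rintro x ⟨h1, h2, h3, h4⟩
    split_ifs <;> omega
  · rintro x ⟨h1, h2, h3, h4⟩ y ⟨h5, h6, h7, h8⟩ hxy
    dsimp only at hxy
    split_ifs at hxy <;> omega
  · rintro x ⟨h1, h2, h3, h4⟩ y ⟨h5, h6, h7, h8⟩
    simp only [fenceLt_iff]
    split_ifs <;> omega

/-- It suffices to generate the composition of `α` with the map moving an isolated point `p` of the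
image down to `k + 1`. -/
theorem mem_closure_of_moveSingle (hα : α ∈ IFset n) {k p : ℕ} (hkp : k < p) (hpn : p ≤ n)
    (hk : k ∉ α.im) (hp : p - 1 ∉ α.im) (hp' : p + 1 ∉ α.im)
    (h : ∀ β ∈ IFset n, (∀ x z, (x, z) ∈ β.graph ↔
      ∃ y, (x, y) ∈ α.graph ∧ z = if y = p then k + 1 else if k < y ∧ y < p then y + 2 else y) →
      β ∈ Subsemigroup.closure (Jset n)) : α ∈ Subsemigroup.closure (Jset n) := by
  obtain ⟨μ, hμ, hg⟩ := exists_mem_Jset_moveFront (n := n) (p := p) (by omega) hpn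
  obtain ⟨ν, hν, hg'⟩ := exists_mem_Jset_moveFront (n := n) (p := k + 1) (by omega) (by omega)
  have key : ∀ x y, (x, y) ∈ α.graph → y ∈ puncture n (p - 1) (p + 1) ∧ y ≠ k := by
    intro x y hxy
    obtain ⟨-, -, h1, h2⟩ := bounds hxy
    exact ⟨⟨h1, h2, fun h => hp (h ▸ ⟨x, hxy⟩), fun h => hp' (h ▸ ⟨x, hxy⟩)⟩,
      fun h => hk (h ▸ ⟨x, hxy⟩)⟩
  have key' : ∀ x y z, (x, y) ∈ α.graph →
      ((∃ w, (y, w) ∈ μ.graph ∧ (w, z) ∈ ν.inv.graph) ↔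
        z = if y = p then k + 1 else if k < y ∧ y < p then y + 2 else y) := by
    intro x y z hxy
    obtain ⟨⟨h1, h2, h3, h4⟩, h5⟩ := key x y hxy
    simp only [hg, mem_inv, hg', puncture, Set.mem_ofPred_eq]
    constructor
    · rintro ⟨w, ⟨-, hw⟩, hz, hw'⟩
      split_ifs at * <;> omega
    · intro hz
      refine ⟨_, ⟨⟨h1, h2, h3, h4⟩, rfl⟩, ?_⟩
      split_ifs at * <;> omega
  refine mem_closure_of_mul_Jset hμ ?_
    (mem_closure_of_mul_Jset (inv_mem_Jset hν) ?_
      (h _ (mul_mem_IFset (mul_mem_IFset hα hμ.1) (inv_mem_Jset hν).1) ?_))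
  · rintro y ⟨x, hxy⟩
    exact ⟨_, (hg _ _).2 ⟨(key x y hxy).1, rfl⟩⟩
  · rintro w ⟨x, y, hxy, hyw⟩
    obtain ⟨w', h1, h2⟩ := (key' x y _ hxy).2 rfl
    exact ⟨_, (eq_right hyw h1) ▸ h2⟩
  · intro x z
    rw [mul_assoc]
    constructor
    · rintro ⟨y, hxy, hyz⟩
      exact ⟨y, hxy, (key' x y z hxy).1 hyz⟩
    · rintro ⟨y, hxy, hyz⟩
      exact ⟨y, hxy, (key' x y z hxy).2 hyz⟩

theorem pid_compl_mem_closure (F : Finset ℕ) :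
    pid n (↑F)ᶜ ∈ Subsemigroup.closure (Jset n) := by
  have single : ∀ a, pid n {a}ᶜ ∈ Jset n := by
    intro a
    obtain ⟨μ, hμ, hg⟩ := exists_mem_Jset_of_puncture n id a a
      (fun x hx => ⟨hx.1, hx.2.1⟩) (Set.injOn_id _) (fun _ _ _ _ => Iff.rfl)
    convert hμ
    apply ext'
    ext ⟨x, y⟩
    rw [hg]
    simp only [pid, puncture, Set.mem_ofPred_eq, Set.mem_Icc, Set.mem_compl_iff,
      Set.mem_singleton_iff, id]
    tauto
  induction F using Finset.induction with
  | empty =>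
    have h : pid n (↑(∅ : Finset ℕ))ᶜ = pid n {0}ᶜ := by
      apply ext'
      ext ⟨x, y⟩
      have h0 : (1 ≤ x ∧ x ≤ n) → x ≠ 0 := by omega
      simp only [pid, Set.mem_ofPred_eq, Set.mem_Icc, Set.mem_compl_iff, Set.mem_singleton_iff,
        Finset.coe_empty, Set.mem_empty_iff_false]
      tauto
    rw [h]
    exact Subsemigroup.subset_closure (single 0)
  | insert a F _ ih =>
    convert mul_mem ih (Subsemigroup.subset_closure (single a)) using 1
    apply ext'
    ext ⟨x, y⟩
    rw [mem_mul]
    simp only [pid, Set.mem_ofPred_eq, Set.mem_Icc, Set.mem_compl_iff, Set.mem_singleton_iff,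
      Finset.coe_insert, Set.mem_insert_iff]
    constructor
    · rintro ⟨h1, h2, rfl⟩
      exact ⟨y, ⟨h1, fun h => h2 (Or.inr h), rfl⟩, h1, fun h => h2 (Or.inl h), rfl⟩
    · rintro ⟨z, ⟨h1, h2, rfl⟩, -, h4, rfl⟩
      exact ⟨h1, fun h => h.elim h4 h2, rfl⟩

theorem mem_closure_of_forall_eq (h : ∀ x y, (x, y) ∈ α.graph → y = x) :
    α ∈ Subsemigroup.closure (Jset n) := by
  classical
  convert pid_compl_mem_closure (n := n) ((Finset.Icc 1 n).filter (· ∉ α.dom))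
  apply ext'
  ext ⟨x, y⟩
  simp only [pid, Set.mem_ofPred_eq, Set.mem_Icc, Set.mem_compl_iff, Finset.coe_filter,
    Finset.mem_Icc]
  constructor
  · intro hxy
    obtain ⟨h1, h2, -, -⟩ := bounds hxy
    exact ⟨⟨h1, h2⟩, fun hx => hx.2 ⟨y, hxy⟩, h x y hxy⟩
  · rintro ⟨hx, h2, rfl⟩
    obtain ⟨z, hz⟩ : y ∈ α.dom := by
      by_contra hc
      exact h2 ⟨hx, hc⟩
    exact (h y z hz) ▸ hz

/-- `k` is a cut point of `α`: it lies outside domain and image, and `α` is the identity below it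
and preserves the set of points above it. -/
def MatchedBelow (k : ℕ) (α : PartialInj n) : Prop :=
  ∀ x y, (x, y) ∈ α.graph → (x < k ∧ y = x) ∨ (k < x ∧ k < y)

theorem MatchedBelow.inv {k : ℕ} (h : MatchedBelow k α) : MatchedBelow k α.inv := by
  intro x y hxy
  have := h y x hxy
  omega

theorem MatchedBelow.notMem_dom {k : ℕ} (h : MatchedBelow k α) : k ∉ α.dom := by
  rintro ⟨y, hy⟩
  have := h _ _ hy
  omega

theorem MatchedBelow.notMem_im {k : ℕ} (h : MatchedBelow k α) : k ∉ α.im := by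
  rintro ⟨y, hy⟩
  have := h _ _ hy
  omega

/-- `{k + 1, …, k + m}` is a maximal block of the domain. -/
def DomBlock (k m : ℕ) (α : PartialInj n) : Prop :=
  (∀ r, 1 ≤ r → r ≤ m → k + r ∈ α.dom) ∧ k ∉ α.dom ∧ k + m + 1 ∉ α.dom

/-- `α` shifts `{k + 1, …, k + m}` onto `{c + 1, …, c + m}`. -/
def Shifts (k m c : ℕ) (α : PartialInj n) : Prop :=
  ∀ r, 1 ≤ r → r ≤ m → (k + r, c + r) ∈ α.graph

/-- `α` maps `{k + 1, …, k + m}` onto `{c + 1, …, c + m}`, reversing the order. -/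
def Flips (k m c : ℕ) (α : PartialInj n) : Prop :=
  ∀ r, 1 ≤ r → r ≤ m → (k + r, c + m + 1 - r) ∈ α.graph

theorem adjacent_of_mem_IFset (hα : α ∈ IFset n) {x y x' y' : ℕ} (h : (x, y) ∈ α.graph)
    (h' : (x', y') ∈ α.graph) : (x + 1 = x' ∨ x' + 1 = x) ↔ (y + 1 = y' ∨ y' + 1 = y) := by
  have h1 := mem_IFset_iff.1 hα _ _ _ _ h h'
  have h2 := mem_IFset_iff.1 hα _ _ _ _ h' h
  simp only [fenceLt_iff] at h1 h2
  omega

theorem exists_shifts_or_flips (hα : α ∈ IFset n) (k m : ℕ) (hm : 1 ≤ m)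
    (hdom : ∀ r, 1 ≤ r → r ≤ m → k + r ∈ α.dom) :
    ∃ c, Shifts k m c α ∨ Flips k m c α := by
  induction m, hm using Nat.le_induction with
  | base =>
    obtain ⟨y, hy⟩ := hdom 1 le_rfl le_rfl
    have := bounds hy
    refine ⟨y - 1, Or.inl fun r h1 h2 => ?_⟩
    obtain rfl : r = 1 := by omega
    rwa [Nat.sub_add_cancel (by omega)]
  | succ m hm ih =>
    obtain ⟨c, hc⟩ := ih fun r h1 h2 => hdom r h1 (by omega)
    obtain ⟨y, hy⟩ := hdom (m + 1) (by omega) le_rfl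
    have hb := bounds hy
    have extShift : Shifts k m c α → y = c + m + 1 → Shifts k (m + 1) c α := by
      intro hs hyc r h1 h2
      rcases Nat.lt_or_ge m r with h | h
      · obtain rfl : r = m + 1 := by omega
        rw [hyc] at hy
        exact hy
      · exact hs r h1 h
    have extFlip : Flips k m c α → y = c → Flips k (m + 1) (c - 1) α := by
      intro hs hyc r h1 h2
      rcases Nat.lt_or_ge m r with h | h
      · obtain rfl : r = m + 1 := by omega
        convert hy using 2
        omega
      · convert hs r h1 h using 2
        omega
    have swap : m = 1 → (Shifts k m c α ↔ Flips k m c α) := by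
      rintro rfl
      refine forall_congr' fun r => forall_congr' fun h1 => forall_congr' fun h2 => ?_
      obtain rfl : r = 1 := by omega
      rfl
    rcases hc with hs | hs
    · have h1 := (adjacent_of_mem_IFset hα (hs m hm le_rfl) hy).1 (by omega)
      by_cases hyc : y = c + m + 1
      · exact ⟨c, Or.inl (extShift hs hyc)⟩
      · rcases Nat.lt_or_ge 1 m with h | h
        · have h2 := hs (m - 1) (by omega) (by omega)
          obtain rfl : y = c + (m - 1) := by omega
          have := eq_left hy h2
          omega
        · exact ⟨c - 1, Or.inr (extFlip ((swap (by omega)).1 hs) (by omega))⟩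
    · have h1 := (adjacent_of_mem_IFset hα (hs m hm le_rfl) hy).1 (by omega)
      by_cases hyc : y = c
      · exact ⟨c - 1, Or.inr (extFlip hs hyc)⟩
      · rcases Nat.lt_or_ge 1 m with h | h
        · have h2 := hs (m - 1) (by omega) (by omega)
          obtain rfl : y = c + m + 1 - (m - 1) := by omega
          have := eq_left hy h2
          omega
        · exact ⟨c, Or.inl (extShift ((swap (by omega)).2 hs) (by omega))⟩

theorem notMem_im_of_shifts (hα : α ∈ IFset n) {k m c : ℕ} (hm : 1 ≤ m) (hb : DomBlock k m α)
    (hs : Shifts k m c α) : c ∉ α.im ∧ c + m + 1 ∉ α.im := by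
  obtain ⟨-, h2, h3⟩ := hb
  constructor
  · rintro ⟨x, hx⟩
    have h1 := (adjacent_of_mem_IFset hα hx (hs 1 le_rfl hm)).2 (by omega)
    have hxk : x ≠ k := fun h => h2 (h ▸ ⟨c, hx⟩)
    have hxm : x ≠ k + m + 1 := fun h => h3 (h ▸ ⟨c, hx⟩)
    have := eq_right hx ((show k + 2 = x by omega) ▸ hs 2 (by omega) (by omega))
    omega
  · rintro ⟨x, hx⟩
    have h1 := (adjacent_of_mem_IFset hα hx (hs m hm le_rfl)).2 (by omega)
    have hxk : x ≠ k := fun h => h2 (h ▸ ⟨_, hx⟩)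
    have hxm : x ≠ k + m + 1 := fun h => h3 (h ▸ ⟨_, hx⟩)
    have := eq_right hx ((show k + (m - 1) = x by omega) ▸ hs (m - 1) (by omega) (by omega))
    omega

theorem notMem_im_of_flips (hα : α ∈ IFset n) {k m c : ℕ} (hm : 1 ≤ m) (hb : DomBlock k m α)
    (hs : Flips k m c α) : c ∉ α.im ∧ c + m + 1 ∉ α.im := by
  obtain ⟨-, h2, h3⟩ := hb
  constructor
  · rintro ⟨x, hx⟩
    have h1 := (adjacent_of_mem_IFset hα hx (hs m hm le_rfl)).2 (by omega)
    have hxk : x ≠ k := fun h => h2 (h ▸ ⟨_, hx⟩)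
    have hxm : x ≠ k + m + 1 := fun h => h3 (h ▸ ⟨_, hx⟩)
    have := eq_right hx ((show k + (m - 1) = x by omega) ▸ hs (m - 1) (by omega) (by omega))
    omega
  · rintro ⟨x, hx⟩
    have h1 := (adjacent_of_mem_IFset hα hx (hs 1 le_rfl hm)).2 (by omega)
    have hxk : x ≠ k := fun h => h2 (h ▸ ⟨_, hx⟩)
    have hxm : x ≠ k + m + 1 := fun h => h3 (h ▸ ⟨_, hx⟩)
    have := eq_right hx ((show k + 2 = x by omega) ▸ hs 2 (by omega) (by omega))
    omega

/-- Every element matched below some point above `k` is generated by `J`. -/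
def GeneratedAbove (n k : ℕ) : Prop :=
  ∀ k', k < k' → ∀ α ∈ IFset n, MatchedBelow k' α → α ∈ Subsemigroup.closure (Jset n)

section Step

variable {k m c : ℕ}

theorem mem_closure_of_fixed_block (ih : GeneratedAbove n k) (hα : α ∈ IFset n)
    (hmat : MatchedBelow k α) (hdom : k + m + 1 ∉ α.dom) (him : k + m + 1 ∉ α.im)
    (hs : Shifts k m k α) : α ∈ Subsemigroup.closure (Jset n) := by
  refine ih (k + m + 1) (by omega) α hα fun x y hxy => ?_
  have h1 : x ≠ k + m + 1 := fun h => hdom (h ▸ ⟨_, hxy⟩)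
  have h2 : y ≠ k + m + 1 := fun h => him (h ▸ ⟨_, hxy⟩)
  rcases hmat x y hxy with h | h
  · omega
  · by_cases hx : x < k + m + 1
    · have h3 := hs (x - k) (by omega) (by omega)
      rw [show k + (x - k) = x by omega] at h3
      have := eq_right hxy h3
      omega
    · by_cases hy : y < k + m + 1
      · have h3 := hs (y - k) (by omega) (by omega)
        rw [show k + (y - k) = y by omega] at h3
        have := eq_left hxy h3
        omega
      · omega

/-- Reversing the part of the image between the cut point `k` and the far end of the image of a
block brings that image to the front, with the opposite orientation. -/
theorem mem_closure_of_reverse_to_front (hα : α ∈ IFset n) (hmat : MatchedBelow k α)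
    (hm : 1 ≤ m) (hkc : k ≤ c) (hcm : c + m ≤ n) (hpar : (k + c + m) % 2 = 1) (hc : c ∉ α.im)
    (hcm' : c + m + 1 ∉ α.im)
    (h : ∀ β ∈ IFset n, MatchedBelow k β → β.dom = α.dom → k + m + 1 ∉ β.im →
      (Shifts k m c α → Flips k m k β) → (Flips k m c α → Shifts k m k β) →
      β ∈ Subsemigroup.closure (Jset n)) : α ∈ Subsemigroup.closure (Jset n) := by
  refine mem_closure_of_reversal hα (i := k) (j := c + m + 1) (by omega) (by omega)
    hmat.notMem_im hcm' fun β hβ hg => h β hβ ?_ ?_ ?_ ?_ ?_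
  · intro x z hxz
    obtain ⟨y, hxy, hz⟩ := (hg x z).1 hxz
    have := hmat x y hxy
    split_ifs at hz <;> omega
  · ext x
    constructor
    · rintro ⟨z, hz⟩
      obtain ⟨y, hxy, -⟩ := (hg x z).1 hz
      exact ⟨y, hxy⟩
    · rintro ⟨y, hxy⟩
      exact ⟨_, (hg _ _).2 ⟨y, hxy, rfl⟩⟩
  · rintro ⟨x, hx⟩
    obtain ⟨y, hxy, hz⟩ := (hg x _).1 hx
    have h1 : y ≠ c := fun h => hc (h ▸ ⟨_, hxy⟩)
    have h2 : y ≠ c + m + 1 := fun h => hcm' (h ▸ ⟨_, hxy⟩)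
    split_ifs at hz <;> omega
  · intro hs r h1 h2
    refine (hg _ _).2 ⟨_, hs r h1 h2, ?_⟩
    split_ifs <;> omega
  · intro hs r h1 h2
    refine (hg _ _).2 ⟨_, hs r h1 h2, ?_⟩
    split_ifs <;> omega

theorem mem_closure_of_flips_of_odd (ih : GeneratedAbove n k) (hα : α ∈ IFset n)
    (hmat : MatchedBelow k α) (hm : 1 ≤ m) (hb : DomBlock k m α) (hs : Flips k m c α)
    (hpar : (k + c + m) % 2 = 1) : α ∈ Subsemigroup.closure (Jset n) := by
  obtain ⟨hc, hc'⟩ := notMem_im_of_flips hα hm hb hs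
  have h1 := hs 1 le_rfl hm
  have h2 := hs m hm le_rfl
  have := bounds h1
  have := hmat _ _ h2
  refine mem_closure_of_reverse_to_front hα hmat hm (by omega) (by omega) hpar hc hc'
    fun β hβ hβm hdom him _ h => ?_
  exact mem_closure_of_fixed_block ih hβ hβm (hdom ▸ hb.2.2) him (h hs)

theorem mem_closure_of_shifts_of_odd (ih : GeneratedAbove n k) (hα : α ∈ IFset n)
    (hmat : MatchedBelow k α) (hm : m % 2 = 1) (hb : DomBlock k m α) (hs : Shifts k m c α)
    (hpar : (k + c) % 2 = 0) : α ∈ Subsemigroup.closure (Jset n) := by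
  have hm' : 1 ≤ m := by omega
  obtain ⟨hc, hc'⟩ := notMem_im_of_shifts hα hm' hb hs
  have h1 := hs 1 le_rfl hm'
  have h2 := hs m hm' le_rfl
  have := bounds h2
  have := hmat _ _ h1
  refine mem_closure_of_reverse_to_front hα hmat hm' (by omega) (by omega) (by omega) hc hc'
    fun β hβ hβm hdom him h _ => ?_
  exact mem_closure_of_flips_of_odd ih hβ hβm hm' (by rwa [DomBlock, hdom]) (h hs) (by omega)

theorem mem_closure_of_single (ih : GeneratedAbove n k) (hα : α ∈ IFset n)
    (hmat : MatchedBelow k α) (hb : DomBlock k 1 α) (hs : Shifts k 1 c α) :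
    α ∈ Subsemigroup.closure (Jset n) := by
  obtain ⟨hc, hc'⟩ := notMem_im_of_shifts hα le_rfl hb hs
  have h1 := hs 1 le_rfl le_rfl
  have := bounds h1
  have := hmat _ _ h1
  refine mem_closure_of_moveSingle hα (k := k) (p := c + 1) (by omega) (by omega) hmat.notMem_im
    (by simpa using hc) hc' fun β hβ hg => ?_
  refine mem_closure_of_fixed_block (m := 1) ih hβ ?_ ?_ ?_ ?_
  · intro x z hxz
    obtain ⟨y, hxy, hz⟩ := (hg x z).1 hxz
    have := hmat x y hxy
    split_ifs at hz <;> omega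
  · rintro ⟨z, hz⟩
    obtain ⟨y, hxy, -⟩ := (hg _ z).1 hz
    exact hb.2.2 ⟨y, hxy⟩
  · rintro ⟨x, hx⟩
    obtain ⟨y, hxy, hz⟩ := (hg x _).1 hx
    have h3 : y ≠ k := fun h => hmat.notMem_im (h ▸ ⟨_, hxy⟩)
    have h4 : y ≠ c := fun h => hc (h ▸ ⟨_, hxy⟩)
    have h5 : y ≠ c + 1 + 1 := fun h => hc' (h ▸ ⟨_, hxy⟩)
    split_ifs at hz <;> omega
  · intro r h3 h4
    obtain rfl : r = 1 := by omega
    exact (hg _ _).2 ⟨_, h1, by simp⟩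

theorem mod_two_of_fence (hα : α ∈ IFset n) {x y x' y' : ℕ} (h : (x, y) ∈ α.graph)
    (h' : (x', y') ∈ α.graph) (hx : x + 1 = x') : x % 2 = y % 2 := by
  have h1 := mem_IFset_iff.1 hα _ _ _ _ h h'
  have h2 := mem_IFset_iff.1 hα _ _ _ _ h' h
  simp only [fenceLt_iff] at h1 h2
  omega

theorem mem_closure_of_odd_block (ih : GeneratedAbove n k) (hα : α ∈ IFset n)
    (hmat : MatchedBelow k α) (hm : m % 2 = 1) (hb : DomBlock k m α) :
    α ∈ Subsemigroup.closure (Jset n) := by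
  obtain ⟨c, hs | hs⟩ := exists_shifts_or_flips hα k m (by omega) hb.1
  · by_cases hm1 : m = 1
    · subst hm1
      exact mem_closure_of_single ih hα hmat hb hs
    · have := mod_two_of_fence hα (hs 1 le_rfl (by omega)) (hs 2 (by omega) (by omega)) rfl
      exact mem_closure_of_shifts_of_odd ih hα hmat hm hb hs (by omega)
  · by_cases hm1 : m = 1
    · subst hm1
      refine mem_closure_of_single (c := c) ih hα hmat hb fun r h1 h2 => ?_
      obtain rfl : r = 1 := by omega
      exact hs 1 le_rfl le_rfl
    · have := mod_two_of_fence hα (hs 1 le_rfl (by omega)) (hs 2 (by omega) (by omega)) rfl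
      exact mem_closure_of_flips_of_odd ih hα hmat (by omega) hb hs (by omega)

theorem mem_closure_of_even_block (ih : GeneratedAbove n k) (hα : α ∈ IFset n)
    (hmat : MatchedBelow k α) (hm : m % 2 = 0) (hm' : 1 ≤ m) (hb : DomBlock k m α) {m' : ℕ}
    (hm'' : m' % 2 = 0) (hb' : DomBlock k m' α.inv) :
    α ∈ Subsemigroup.closure (Jset n) := by
  obtain ⟨c, hs | hs⟩ := exists_shifts_or_flips hα k m hm' hb.1
  · have hpar := mod_two_of_fence hα (hs 1 le_rfl (by omega)) (hs 2 (by omega) (by omega)) rfl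
    obtain ⟨hc, hc'⟩ := notMem_im_of_shifts hα hm' hb hs
    have h1 := hmat _ _ (hs 1 le_rfl hm')
    have h2 := bounds (hs m hm' le_rfl)
    by_cases hck : c = k
    · subst hck
      exact mem_closure_of_fixed_block ih hα hmat hb.2.2 hc' hs
    · have hlt : k + m' + 1 ≤ c := by
        by_contra hlt
        have h3 := hb'.1 (c - k) (by omega) (by omega)
        rw [show k + (c - k) = c by omega] at h3
        exact hc h3
      refine mem_closure_of_reversal hα (i := k + m' + 1) (j := c + m + 1) (by omega)
        (by omega) hb'.2.2 hc' fun β hβ hg => ?_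
      have hdom : β.dom = α.dom := by
        ext x
        constructor
        · rintro ⟨z, hz⟩
          obtain ⟨y, hxy, -⟩ := (hg x z).1 hz
          exact ⟨y, hxy⟩
        · rintro ⟨y, hxy⟩
          exact ⟨_, (hg _ _).2 ⟨y, hxy, rfl⟩⟩
      refine mem_closure_of_flips_of_odd (c := k + m' + 1) ih hβ ?_ hm' (by rwa [DomBlock, hdom])
        ?_ (by omega)
      · intro x z hxz
        obtain ⟨y, hxy, hz⟩ := (hg x z).1 hxz
        have := hmat x y hxy
        split_ifs at hz <;> omega
      · intro r h1 h2
        refine (hg _ _).2 ⟨_, hs r h1 h2, ?_⟩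
        split_ifs <;> omega
  · have := mod_two_of_fence hα (hs 1 le_rfl (by omega)) (hs 2 (by omega) (by omega)) rfl
    exact mem_closure_of_flips_of_odd ih hα hmat hm' hb hs (by omega)

theorem exists_domBlock (hmat : MatchedBelow k α) : ∃ m, DomBlock k m α := by
  classical
  have hex : ∃ m, k + m + 1 ∉ α.dom := ⟨n, fun ⟨y, hy⟩ => by have := bounds hy; omega⟩
  refine ⟨Nat.find hex, fun r h1 h2 => ?_, hmat.notMem_dom, Nat.find_spec hex⟩
  have := Nat.find_min hex (m := r - 1) (by omega)
  rw [not_not] at this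
  rwa [show k + (r - 1) + 1 = k + r by omega] at this

theorem mem_closure_of_matchedBelow (ih : GeneratedAbove n k) (hα : α ∈ IFset n)
    (hmat : MatchedBelow k α) : α ∈ Subsemigroup.closure (Jset n) := by
  obtain ⟨m, hb⟩ := exists_domBlock hmat
  obtain ⟨m', hb'⟩ := exists_domBlock hmat.inv
  rcases Nat.mod_two_eq_zero_or_one m with hm | hm
  · rcases Nat.mod_two_eq_zero_or_one m' with hm' | hm'
    · rcases Nat.eq_zero_or_pos m with h0 | h0
      · rcases Nat.eq_zero_or_pos m' with h0' | h0'
        · subst h0 h0'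
          exact mem_closure_of_fixed_block (m := 0) ih hα hmat hb.2.2 hb'.2.2 fun r h1 h2 => by omega
        · exact mem_closure_of_inv
            (mem_closure_of_even_block ih (inv_mem_IFset hα) hmat.inv hm' h0' hb' hm hb)
      · exact mem_closure_of_even_block ih hα hmat hm h0 hb hm' hb'
    · exact mem_closure_of_inv
        (mem_closure_of_odd_block ih (inv_mem_IFset hα) hmat.inv hm' hb')
  · exact mem_closure_of_odd_block ih hα hmat hm hb

end Step

theorem generatedAbove (n k : ℕ) : GeneratedAbove n k := by
  obtain ⟨d, hd⟩ : ∃ d, n ≤ k + d := ⟨n, by omega⟩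
  induction d generalizing k with
  | zero =>
    intro k' hk' α _ hmat
    refine mem_closure_of_forall_eq fun x y hxy => ?_
    have := hmat x y hxy
    have := bounds hxy
    omega
  | succ d ih =>
    intro k' hk' α hα hmat
    exact mem_closure_of_matchedBelow (ih k' (by omega)) hα hmat

/-- Theorem 1: `IF_n = ⟨J⟩`. -/
theorem theo1 (n : ℕ) :
    IFset n = ↑(Subsemigroup.closure (Jset n)) := by
  refine Set.Subset.antisymm (fun α hα => ?_) closure_subset_IFset
  refine mem_closure_of_matchedBelow (generatedAbove n 0) hα fun x y hxy => ?_
  have := bounds hxy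
  omega

end FencePaper
end

section
/- Let n be even. Then IF_n = ⟨G⟩, i.e. every element of IF_n is a finite product of elements of G. -/
/-!
Common framework: partial injections on `X_n = {1, …, n}`, the fence order,
fence-preserving partial injections, the semigroups `PFI_n`, `IF_n`,
the set `J` of elements of rank at least `n - 2`, and (for even `n`)
the generating system `G`.
-/

namespace FencePaper

open PartialInj

namespace PartialInj

variable {n : ℕ}

theorem mem_IFset_iff {α : PartialInj n} : α ∈ IFset n ↔
    ∀ x y x' y', (x, y) ∈ α.graph → (x', y') ∈ α.graph → (fenceLt x x' ↔ fenceLt y y') :=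
  ⟨fun h x y x' y' hx hx' => ⟨h.1 (x, y) hx (x', y') hx', h.2 (y, x) hx (y', x') hx'⟩,
    fun h => ⟨fun p hp q hq => (h p.1 p.2 q.1 q.2 hp hq).1,
      fun p hp q hq => (h p.2 p.1 q.2 q.1 hp hq).2⟩⟩

theorem inv_mem_IFset {α : PartialInj n} (h : α ∈ IFset n) : α.inv ∈ IFset n :=
  ⟨h.2, h.1⟩

theorem mul_mem_IFset {α β : PartialInj n} (hα : α ∈ IFset n) (hβ : β ∈ IFset n) :
    α * β ∈ IFset n := by
  rw [mem_IFset_iff] at *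
  rintro x y x' y' ⟨z, h1, h2⟩ ⟨z', h1', h2'⟩
  exact (hα _ _ _ _ h1 h1').trans (hβ _ _ _ _ h2 h2')

theorem fenceLt_iff (a b : ℕ) : fenceLt a b ↔ (a + 1 = b ∨ b + 1 = a) ∧ b % 2 = 0 := by
  rw [fenceLt, Nat.even_iff]

theorem adjacent_image {α : PartialInj n} (h : α ∈ IFset n) {x y z : ℕ}
    (h1 : (x, y) ∈ α.graph) (h2 : (x + 1, z) ∈ α.graph) :
    (z = y + 1 ∨ y = z + 1) ∧ x % 2 = y % 2 := by
  have e1 := mem_IFset_iff.1 h _ _ _ _ h1 h2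
  have e2 := mem_IFset_iff.1 h _ _ _ _ h2 h1
  simp only [fenceLt_iff, true_or, or_true, true_and] at e1 e2
  omega

/-- The reversal of the open interval `(i, j)`, undefined at `i` and `j`. -/
def reversal (n i j : ℕ) (hj : j ≤ n + 1) : PartialInj n where
  graph := betaGraph n i j
  mem_le := by
    rintro ⟨x, y⟩ ⟨h1, h2, h3, h4, h5⟩
    dsimp only at *
    split_ifs at h5 <;> omega
  functional := by
    rintro ⟨x, y⟩ ⟨-, -, -, -, h⟩ ⟨x', y'⟩ ⟨-, -, -, -, h'⟩ e
    dsimp only at *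
    rw [h, h', e]
  injOn := by
    rintro ⟨x, y⟩ ⟨h1, h2, h3, h4, h5⟩ ⟨x', y'⟩ ⟨h1', h2', h3', h4', h5'⟩ e
    dsimp only at *
    split_ifs at h5 h5' <;> omega

theorem mem_reversal {i j : ℕ} {hj : j ≤ n + 1} {x y : ℕ} :
    (x, y) ∈ (reversal n i j hj).graph ↔ 1 ≤ x ∧ x ≤ n ∧ x ≠ i ∧ x ≠ j ∧
      ((i < x ∧ x < j ∧ x + y = i + j) ∨ (¬ (i < x ∧ x < j) ∧ y = x)) := by
  change (1 ≤ x ∧ x ≤ n ∧ x ≠ i ∧ x ≠ j ∧ y = if i < x ∧ x < j then i + j - x else x) ↔ _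
  split_ifs <;> omega

theorem reversal_parity {i j : ℕ} {hj : j ≤ n + 1} (hij : i % 2 = j % 2) {x y : ℕ}
    (h : (x, y) ∈ (reversal n i j hj).graph) : x % 2 = y % 2 := by
  rw [mem_reversal] at h
  omega

theorem reversal_mem_IFset {i j : ℕ} (hj : j ≤ n + 1) (hij : i % 2 = j % 2) :
    reversal n i j hj ∈ IFset n := by
  rw [mem_IFset_iff]
  intro x y x' y' h h'
  rw [mem_reversal] at h h'
  simp only [fenceLt_iff]
  omega

theorem mem_pid {D : Set ℕ} {x y : ℕ} :
    (x, y) ∈ (pid n D).graph ↔ (1 ≤ x ∧ x ≤ n) ∧ x ∈ D ∧ y = x := Iff.rfl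

/-- A subsemigroup with all partial identities is closed under restriction. -/
theorem mem_of_graph_subset {S : Subsemigroup (PartialInj n)} (hS : ∀ D, pid n D ∈ S)
    {α s : PartialInj n} (hs : s ∈ S) (h : α.graph ⊆ s.graph) : α ∈ S := by
  have : α = pid n α.dom * s := by
    apply ext'
    ext ⟨x, y⟩
    constructor
    · intro hx
      have := α.mem_le _ hx
      exact ⟨x, ⟨⟨this.1, this.2.1⟩, ⟨y, hx⟩, rfl⟩, h hx⟩
    · rintro ⟨z, ⟨-, ⟨y', hy'⟩, hz⟩, h2⟩
      dsimp only at *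
      subst hz
      have : y = y' := s.functional _ h2 _ (h hy') rfl
      rwa [this]
  rw [this]
  exact S.mul_mem (hS _) hs

theorem mem_of_reversal_mul_mem {S : Subsemigroup (PartialInj n)} (hS : ∀ D, pid n D ∈ S)
    {i j : ℕ} {hj : j ≤ n + 1} (hβ : reversal n i j hj ∈ S)
    {α : PartialInj n} (hi : i ∉ α.dom) (hj' : j ∉ α.dom)
    (h : reversal n i j hj * α ∈ S) : α ∈ S := by
  refine mem_of_graph_subset hS (S.mul_mem hβ h) ?_
  rintro ⟨x, y⟩ hx
  have hb := α.mem_le _ hx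
  have hxi : x ≠ i := by rintro rfl; exact hi ⟨y, hx⟩
  have hxj : x ≠ j := by rintro rfl; exact hj' ⟨y, hx⟩
  dsimp only at hb
  by_cases hc : i < x ∧ x < j
  · refine ⟨i + j - x, ?_, x, ?_, hx⟩ <;> dsimp only <;> rw [mem_reversal] <;> omega
  · refine ⟨x, ?_, x, ?_, hx⟩ <;> dsimp only <;> rw [mem_reversal] <;> omega

/-- A maximal block `(m, l)` of the domain is carried to a maximal block of the image,
either by a translation or by a reflection. -/
theorem exists_image_block {α : PartialInj n} (h : α ∈ IFset n) {m l : ℕ} (hml : m + 1 < l)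
    (hm : m ∉ α.dom) (hl : l ∉ α.dom) (hin : ∀ x, m < x → x < l → x ∈ α.dom) :
    ∃ m' l', m' + l = m + l' ∧ l' ≤ n + 1 ∧ m' ∉ α.im ∧ l' ∉ α.im ∧
      ((∀ x z, m < x → x < l → z + m = x + m' → (x, z) ∈ α.graph) ∨
        ∀ x z, m < x → x < l → z + x = l' + m → (x, z) ∈ α.graph) := by
  obtain ⟨y, hy⟩ := hin (m + 1) (by omega) hml
  have hyb := α.mem_le _ hy
  dsimp only at hyb
  have hinv := inv_mem_IFset h
  have key : (∀ k, m + 1 + k < l → (m + 1 + k, y + k) ∈ α.graph) ∨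
      (∀ k, m + 1 + k < l → ∃ z, z + k = y ∧ (m + 1 + k, z) ∈ α.graph) := by
    by_cases h2 : m + 2 < l
    · obtain ⟨y1, hy1⟩ := hin (m + 2) (by omega) h2
      rcases (adjacent_image h hy hy1).1 with e | e
      · left
        intro k
        induction k using Nat.strong_induction_on with
        | _ k ih =>
          intro hk
          match k, ih, hk with
          | 0, _, _ => exact hy
          | 1, _, _ => rw [e] at hy1; exact hy1
          | k + 2, ih, hk =>
            have i0 := ih k (by omega) (by omega)
            have i1 := ih (k + 1) (by omega) (by omega)
            obtain ⟨z, hz⟩ := hin (m + 1 + (k + 2)) (by omega) hk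
            rcases (adjacent_image h i1 hz).1 with e | e
            · rw [e] at hz; exact hz
            · have : y + k = z := by omega
              subst this
              have := α.injOn _ i0 _ hz rfl
              dsimp only at this
              omega
      · right
        intro k
        induction k using Nat.strong_induction_on with
        | _ k ih =>
          intro hk
          match k, ih, hk with
          | 0, _, _ => exact ⟨y, rfl, hy⟩
          | 1, _, _ => exact ⟨y1, by omega, hy1⟩
          | k + 2, ih, hk =>
            obtain ⟨z0, e0, i0⟩ := ih k (by omega) (by omega)
            obtain ⟨z1, e1, i1⟩ := ih (k + 1) (by omega) (by omega)
            obtain ⟨z, hz⟩ := hin (m + 1 + (k + 2)) (by omega) hk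
            rcases (adjacent_image h i1 hz).1 with e | e
            · have : z0 = z := by omega
              subst this
              have := α.injOn _ i0 _ hz rfl
              dsimp only at this
              omega
            · exact ⟨z, by omega, hz⟩
    · left
      intro k hk
      obtain rfl : k = 0 := by omega
      exact hy
  rcases key with key | key
  · have key' : ∀ x z, m < x → x < l → z + m = x + (y - 1) → (x, z) ∈ α.graph := by
      intro x z h1 h2 h3
      have := key (x - m - 1) (by omega)
      convert this using 2 <;> omega
    have hlast := key' (l - 1) (l - 1 + (y - 1) - m) (by omega) (by omega) (by omega)
    have hlastb := α.mem_le _ hlast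
    dsimp only at hlastb
    refine ⟨y - 1, y + l - m - 1, by omega, by omega, ?_, ?_, Or.inl key'⟩
    · rintro ⟨x, hx⟩
      have hy' : (y - 1 + 1, m + 1) ∈ α.inv.graph := by
        rw [Nat.sub_add_cancel hyb.2.2.1]; exact hy
      rcases (adjacent_image hinv (show (y - 1, x) ∈ α.inv.graph from hx) hy').1 with e | e
      · obtain rfl : x = m := by omega
        exact hm ⟨_, hx⟩
      · by_cases hxl : x < l
        · have := α.functional _ hx _ (key' x (x + (y - 1) - m) (by omega) hxl (by omega)) rfl
          dsimp only at this
          omega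
        · obtain rfl : x = l := by omega
          exact hl ⟨_, hx⟩
    · rintro ⟨x, hx⟩
      have hy' : (l - 1 + (y - 1) - m + 1, x) ∈ α.inv.graph := by
        rw [show l - 1 + (y - 1) - m + 1 = y + l - m - 1 by omega]
        exact hx
      rcases (adjacent_image hinv (show (l - 1 + (y - 1) - m, l - 1) ∈ α.inv.graph from hlast)
        hy').1 with e | e
      · obtain rfl : x = l := by omega
        exact hl ⟨_, hx⟩
      · by_cases hxm : m < x
        · have := α.functional _ hx _ (key' x (x + (y - 1) - m) hxm (by omega) (by omega)) rfl
          dsimp only at this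
          omega
        · obtain rfl : x = m := by omega
          exact hm ⟨_, hx⟩
  · have key' : ∀ x z, m < x → x < l → z + x = (y + 1) + m → (x, z) ∈ α.graph := by
      intro x z h1 h2 h3
      obtain ⟨z', e, hz'⟩ := key (x - m - 1) (by omega)
      convert hz' using 2 <;> omega
    obtain ⟨z, ez, hz⟩ := key (l - m - 2) (by omega)
    have hzb := α.mem_le _ hz
    dsimp only at hzb
    rw [show m + 1 + (l - m - 2) = l - 1 by omega] at hz
    refine ⟨z - 1, y + 1, by omega, by omega, ?_, ?_, Or.inr key'⟩
    · rintro ⟨x, hx⟩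
      have hz' : (z - 1 + 1, l - 1) ∈ α.inv.graph := by
        rw [Nat.sub_add_cancel hzb.2.2.1]; exact hz
      rcases (adjacent_image hinv (show (z - 1, x) ∈ α.inv.graph from hx) hz').1 with e | e
      · by_cases hxm : m < x
        · have := α.functional _ hx _ (key' x (y + 1 + m - x) hxm (by omega) (by omega)) rfl
          dsimp only at this
          omega
        · obtain rfl : x = m := by omega
          exact hm ⟨_, hx⟩
      · obtain rfl : x = l := by omega
        exact hl ⟨_, hx⟩
    · rintro ⟨x, hx⟩
      rcases (adjacent_image hinv (show (y, m + 1) ∈ α.inv.graph from hy)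
        (show (y + 1, x) ∈ α.inv.graph from hx)).1 with e | e
      · by_cases hxl : x < l
        · have := α.functional _ hx _ (key' x (y + 1 + m - x) (by omega) hxl (by omega)) rfl
          dsimp only at this
          omega
        · obtain rfl : x = l := by omega
          exact hl ⟨_, hx⟩
      · obtain rfl : x = m := by omega
        exact hm ⟨_, hx⟩

open Classical in
theorem card_dom_filter_le (α : PartialInj n) {P Q : ℕ → Prop}
    [DecidablePred P] [DecidablePred Q]
    (h : ∀ x y, (x, y) ∈ α.graph → P x → Q y) :
    ((Finset.range (n + 1)).filter fun x => x ∈ α.dom ∧ P x).card ≤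
      ((Finset.range (n + 1)).filter fun y => y ∈ α.im ∧ Q y).card := by
  refine Finset.card_le_card_of_forall_subsingleton (fun x y => (x, y) ∈ α.graph) ?_ ?_
  · intro x hx
    obtain ⟨-, ⟨y, hy⟩, hP⟩ := Finset.mem_filter.1 hx
    have hb := α.mem_le _ hy
    dsimp only at hb
    exact ⟨y, Finset.mem_filter.2 ⟨Finset.mem_range.2 (by omega), ⟨x, hy⟩, h _ _ hy hP⟩, hy⟩
  · rintro y - x ⟨-, hx⟩ x' ⟨-, hx'⟩
    exact α.injOn _ hx _ hx' rfl

open Classical in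
theorem card_adjacent_le {α : PartialInj n} (h : α ∈ IFset n) :
    ((Finset.range (n + 1)).filter fun x => x ∈ α.dom ∧ x + 1 ∈ α.dom).card ≤
      ((Finset.range (n + 1)).filter fun y => y ∈ α.im ∧ y + 1 ∈ α.im).card := by
  refine Finset.card_le_card_of_forall_subsingleton
    (fun x y => ((x, y) ∈ α.graph ∧ (x + 1, y + 1) ∈ α.graph) ∨
      ((x, y + 1) ∈ α.graph ∧ (x + 1, y) ∈ α.graph)) ?_ ?_
  · intro x hx
    obtain ⟨-, ⟨y, hy⟩, z, hz⟩ := Finset.mem_filter.1 hx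
    have hb := α.mem_le _ hy
    have hb' := α.mem_le _ hz
    dsimp only at hb hb'
    rcases (adjacent_image h hy hz).1 with rfl | rfl
    · exact ⟨y, Finset.mem_filter.2 ⟨Finset.mem_range.2 (by omega), ⟨x, hy⟩, _, hz⟩,
        Or.inl ⟨hy, hz⟩⟩
    · exact ⟨z, Finset.mem_filter.2 ⟨Finset.mem_range.2 (by omega), ⟨_, hz⟩, _, hy⟩,
        Or.inr ⟨hy, hz⟩⟩
  · rintro y - x ⟨-, hx⟩ x' ⟨-, hx'⟩
    have inj : ∀ {a b c}, (a, c) ∈ α.graph → (b, c) ∈ α.graph → a = b :=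
      fun h1 h2 => α.injOn _ h1 _ h2 rfl
    rcases hx with ⟨h1, h2⟩ | ⟨h1, h2⟩ <;> rcases hx' with ⟨h3, h4⟩ | ⟨h3, h4⟩
    · exact inj h1 h3
    · have := inj h1 h4
      have := inj h2 h3
      omega
    · have := inj h1 h4
      have := inj h2 h3
      omega
    · exact inj h1 h3

open Classical in
/-- The positions `x` such that neither `x` nor `x + 1` is in `D`. -/
noncomputable def gaps (n : ℕ) (D : Set ℕ) : Finset ℕ :=
  (Finset.range (n + 1)).filter fun x => x ∉ D ∧ x + 1 ∉ D

theorem mem_gaps {D : Set ℕ} {x : ℕ} : x ∈ gaps n D ↔ x ≤ n ∧ x ∉ D ∧ x + 1 ∉ D := by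
  simp [gaps]

open Classical in
theorem card_gaps_add (D : Set ℕ) (h0 : 0 ∉ D) (h1 : n + 1 ∉ D) :
    (gaps n D).card + 2 * ((Finset.range (n + 1)).filter fun x => x ∈ D).card =
      n + 1 + ((Finset.range (n + 1)).filter fun x => x ∈ D ∧ x + 1 ∈ D).card := by
  have hs : ∑ x ∈ Finset.range (n + 1), (if x + 1 ∈ D then 1 else 0) =
      ∑ x ∈ Finset.range (n + 1), (if x ∈ D then 1 else 0) := by
    have e1 := Finset.sum_range_succ (fun x => if x ∈ D then 1 else 0) (n + 1)
    have e2 := Finset.sum_range_succ' (fun x => if x ∈ D then 1 else 0) (n + 1)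
    simp only [h0, h1, if_false, add_zero] at e1 e2
    rw [← e1, ← e2]
  simp only [gaps, Finset.card_filter]
  rw [two_mul]
  nth_rw 2 [← hs]
  rw [← Finset.sum_add_distrib, ← Finset.sum_add_distrib]
  have : n + 1 = ∑ x ∈ Finset.range (n + 1), 1 := by simp
  conv_rhs => lhs; rw [this]
  rw [← Finset.sum_add_distrib]
  refine Finset.sum_congr rfl fun x _ => ?_
  by_cases a : x ∈ D <;> by_cases b : x + 1 ∈ D <;> simp [a, b]

theorem zero_not_mem_dom (α : PartialInj n) : 0 ∉ α.dom := by
  rintro ⟨y, hy⟩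
  have := α.mem_le _ hy
  dsimp only at this
  omega

theorem mem_dom_le {α : PartialInj n} {x : ℕ} (h : x ∈ α.dom) : x ≤ n := by
  obtain ⟨y, hy⟩ := h
  exact (α.mem_le _ hy).2.1

theorem succ_not_mem_dom (α : PartialInj n) : n + 1 ∉ α.dom :=
  fun h => by simpa using mem_dom_le h

theorem card_gaps_dom {α : PartialInj n} (h : α ∈ IFset n) :
    (gaps n α.dom).card = (gaps n α.im).card := by
  classical
  have e1 := card_gaps_add α.dom α.zero_not_mem_dom α.succ_not_mem_dom
  have e2 := card_gaps_add α.im α.inv.zero_not_mem_dom α.inv.succ_not_mem_dom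
  have c1 := α.card_dom_filter_le (P := fun _ => True) (Q := fun _ => True) (by simp)
  have c2 := α.inv.card_dom_filter_le (P := fun _ => True) (Q := fun _ => True) (by simp)
  have c3 := card_adjacent_le h
  have c4 := card_adjacent_le (inv_mem_IFset h)
  simp only [and_true] at c1 c2
  change _ ≤ ((Finset.range (n + 1)).filter fun y => y ∈ α.dom).card at c2
  change ((Finset.range (n + 1)).filter fun y => y ∈ α.im).card ≤ _ at c2
  change _ ≤ ((Finset.range (n + 1)).filter fun y => y ∈ α.dom ∧ y + 1 ∈ α.dom).card at c4
  change ((Finset.range (n + 1)).filter fun y => y ∈ α.im ∧ y + 1 ∈ α.im).card ≤ _ at c4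
  omega

/-- `α` maps `(p, ∞)` to itself, fixes its domain below `p`, and is undefined at `p`,
which is not in its image either. -/
structure FixesBelow (α : PartialInj n) (p : ℕ) : Prop where
  not_mem_dom : p ∉ α.dom
  not_mem_im : p ∉ α.im
  eq_of_lt : ∀ x y, (x, y) ∈ α.graph → x < p ∨ y < p → x = y

theorem FixesBelow.inv {α : PartialInj n} {p : ℕ} (h : α.FixesBelow p) : α.inv.FixesBelow p :=
  ⟨h.not_mem_im, h.not_mem_dom, fun x y hx hp => (h.eq_of_lt y x hx hp.symm).symm⟩

theorem FixesBelow.lt_iff {α : PartialInj n} {p : ℕ} (h : α.FixesBelow p) {x y : ℕ}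
    (hx : (x, y) ∈ α.graph) : p < x ↔ p < y := by
  have h1 := h.eq_of_lt x y hx
  have h2 : x ≠ p := by rintro rfl; exact h.not_mem_dom ⟨_, hx⟩
  have h3 : y ≠ p := by rintro rfl; exact h.not_mem_im ⟨_, hx⟩
  omega

theorem FixesBelow.mem_dom_iff {α : PartialInj n} {p : ℕ} (h : α.FixesBelow p) {x : ℕ}
    (hx : x ≤ p) : x ∈ α.dom ↔ x ∈ α.im := by
  rcases hx.eq_or_lt with rfl | hx
  · exact iff_of_false h.not_mem_dom h.not_mem_im
  constructor
  · rintro ⟨y, hy⟩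
    rw [← h.eq_of_lt x y hy (Or.inl hx)] at hy
    exact ⟨x, hy⟩
  · rintro ⟨y, hy⟩
    rw [h.eq_of_lt y x hy (Or.inr hx)] at hy
    exact ⟨x, hy⟩

theorem FixesBelow.card_gaps {α : PartialInj n} {p : ℕ} (h : α.FixesBelow p)
    (hα : α ∈ IFset n) :
    ((gaps n α.dom).filter fun x => p ≤ x).card = ((gaps n α.im).filter fun x => p ≤ x).card := by
  have e1 := Finset.card_filter_add_card_filter_not (s := gaps n α.dom) (fun x => p ≤ x)
  have e2 := Finset.card_filter_add_card_filter_not (s := gaps n α.im) (fun x => p ≤ x)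
  have e3 := card_gaps_dom hα
  have : ((gaps n α.dom).filter fun x => ¬ p ≤ x) = (gaps n α.im).filter fun x => ¬ p ≤ x := by
    ext x
    simp only [Finset.mem_filter, mem_gaps]
    refine and_congr_left fun hx => ?_
    rw [h.mem_dom_iff (by omega), h.mem_dom_iff (by omega)]
  rw [this] at e1
  omega

/-- `α` preserves parity. -/
def PreservesParity (α : PartialInj n) : Prop :=
  ∀ x y, (x, y) ∈ α.graph → x % 2 = y % 2

theorem PreservesParity.mul {α β : PartialInj n} (h : α.PreservesParity)
    (h' : β.PreservesParity) : (α * β).PreservesParity := by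
  rintro x y ⟨z, h1, h2⟩
  exact (h _ _ h1).trans (h' _ _ h2)

/-- A parity-preserving `α` which fixes everything below `p` has, beyond `p`, as many missing
positions of the parity of `p` in its domain as in its image. -/
theorem FixesBelow.exists_not_mem_im {α : PartialInj n} {p p' : ℕ} (h : α.FixesBelow p)
    (hpar : α.PreservesParity) (hp : p < p') (hp' : p' ≤ n) (hd : p' ∉ α.dom)
    (hpp : p' % 2 = p % 2) : ∃ l, p < l ∧ l ≤ n ∧ l % 2 = p % 2 ∧ l ∉ α.im := by
  classical
  by_contra! hcon
  have c := α.inv.card_dom_filter_le (P := fun x => p < x ∧ x % 2 = p % 2)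
    (Q := fun x => p < x ∧ x % 2 = p % 2) (fun x y hx hP => by
      have := hpar y x hx
      have := h.lt_iff (show (y, x) ∈ α.graph from hx)
      omega)
  refine absurd c (not_le.2 (Finset.card_lt_card ?_))
  rw [Finset.ssubset_iff_of_subset]
  · refine ⟨p', Finset.mem_filter.2 ⟨Finset.mem_range.2 (by omega), hcon p' hp hp' hpp, hp, hpp⟩,
      fun hm => hd (Finset.mem_filter.1 hm).2.1⟩
  · intro x hx
    obtain ⟨h1, h2, h3, h4⟩ := Finset.mem_filter.1 hx
    exact Finset.mem_filter.2 ⟨h1, hcon x h3 (by have := Finset.mem_range.1 h1; omega) h4, h3, h4⟩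

theorem FixesBelow.reversal_mul {α : PartialInj n} {p q p' q' : ℕ} (h : α.FixesBelow p)
    (hj : q' ≤ n + 1) (hp : p ≤ p') (hpq : p' < q') (hq : q + p' = p + q')
    (hp' : p' ∉ α.dom) (hqi : q ∉ α.im)
    (hR : ∀ x z, p < x → x < q → z + x = q' + p → (z, x) ∈ α.graph) :
    (reversal n p q' hj * α).FixesBelow q := by
  refine ⟨?_, ?_, ?_⟩
  · rintro ⟨y, z, h1, h2⟩
    dsimp only at h1 h2
    rw [mem_reversal] at h1
    obtain rfl : z = p' := by omega
    exact hp' ⟨y, h2⟩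
  · rintro ⟨y, z, h1, h2⟩
    exact hqi ⟨z, h2⟩
  · rintro x y ⟨z, h1, h2⟩ hlt
    dsimp only at h1 h2
    rw [mem_reversal] at h1
    have hl := h.lt_iff h2
    have he := h.eq_of_lt z y h2
    have hyp : y ≠ p := by rintro rfl; exact h.not_mem_im ⟨_, h2⟩
    have e1 : p < x → x < q → y = x := fun hx hx' =>
      α.functional _ h2 _ (hR x z hx hx' (by omega)) rfl
    have e2 : p < y → y < q → z + y = q' + p := fun hy hy' => by
      have : z = q' + p - y :=
        α.injOn _ h2 _ (hR y (q' + p - y) hy hy' (by omega)) rfl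
      omega
    omega

theorem exists_next_not_mem {D : Set ℕ} {p : ℕ} (hp : p < n + 1) (hn : n + 1 ∉ D) :
    ∃ q, p < q ∧ q ≤ n + 1 ∧ q ∉ D ∧ ∀ x, p < x → x < q → x ∈ D := by
  classical
  have he : ∃ q, p < q ∧ q ∉ D := ⟨n + 1, hp, hn⟩
  refine ⟨Nat.find he, (Nat.find_spec he).1, Nat.find_min' he ⟨hp, hn⟩, (Nat.find_spec he).2, ?_⟩
  intro x hx hx'
  by_contra hD
  exact Nat.find_min he hx' ⟨hx, hD⟩

/-- Going back from `l`, the closest position that is not in `D`. -/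
theorem exists_prev_not_mem {D : Set ℕ} {q l : ℕ} (hq : q < l) (hD : q ∉ D) :
    ∃ m, q ≤ m ∧ m < l ∧ m ∉ D ∧ ∀ x, m < x → x < l → x ∈ D := by
  classical
  have he : ∃ k, k < l ∧ l - 1 - k ∉ D :=
    ⟨l - 1 - q, by omega, by rwa [show l - 1 - (l - 1 - q) = q by omega]⟩
  have hmin : Nat.find he ≤ l - 1 - q :=
    Nat.find_min' he ⟨by omega, by rwa [show l - 1 - (l - 1 - q) = q by omega]⟩
  have hs := Nat.find_spec he
  refine ⟨l - 1 - Nat.find he, by omega, by omega, hs.2, ?_⟩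
  intro x hx hx'
  by_contra hD
  exact Nat.find_min he (m := l - 1 - x) (by omega)
    ⟨by omega, by rwa [show l - 1 - (l - 1 - x) = x by omega]⟩

/-- The block `(p, q)` of the image is the image of a block `(p', q')` of the domain (where both
blocks may be empty). -/
structure BlockSource (α : PartialInj n) (p q p' q' : ℕ) : Prop where
  le : p ≤ p'
  lt : p' < q'
  le_succ : q' ≤ n + 1
  size : q + p' = p + q'
  left_not_mem : p' ∉ α.dom
  right_not_mem : q' ∉ α.dom
  mem_of_lt : ∀ x, p' < x → x < q' → x ∈ α.dom
  orientation : ((∀ x z, p < x → x < q → z + p = x + p' → (z, x) ∈ α.graph) ∧ p' % 2 = p % 2) ∨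
    ((∀ x z, p < x → x < q → z + x = q' + p → (z, x) ∈ α.graph) ∧ q' % 2 = p % 2)

theorem FixesBelow.exists_blockSource {α : PartialInj n} {p q : ℕ} (h : α.FixesBelow p)
    (hα : α ∈ IFset n) (hpar : α.PreservesParity) (hpq : p < q) (hqn : q ≤ n + 1) (hq : q ∉ α.im)
    (hin : ∀ x, p < x → x < q → x ∈ α.im) : ∃ p' q', α.BlockSource p q p' q' := by
  by_cases h1 : p + 1 < q
  · obtain ⟨p', q', hs, hq', hpd, hqd, ho⟩ :=
      exists_image_block (inv_mem_IFset hα) h1 h.not_mem_im hq hin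
    change p' ∉ α.dom at hpd
    change q' ∉ α.dom at hqd
    change (∀ x z, p < x → x < q → z + p = x + p' → (z, x) ∈ α.graph) ∨
      (∀ x z, p < x → x < q → z + x = q' + p → (z, x) ∈ α.graph) at ho
    rcases ho with ho | ho
    · have hm := ho (p + 1) (p' + 1) (by omega) h1 (by omega)
      have := h.lt_iff hm
      have := hpar _ _ hm
      refine ⟨p', q', by omega, by omega, hq', by omega, hpd, hqd, ?_, Or.inl ⟨ho, by omega⟩⟩
      intro x hx hx'
      exact ⟨_, ho (x + p - p') x (by omega) (by omega) (by omega)⟩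
    · have hm := ho (q - 1) (p' + 1) (by omega) (by omega) (by omega)
      have := h.lt_iff hm
      have := hpar _ _ hm
      refine ⟨p', q', by omega, by omega, hq', by omega, hpd, hqd, ?_, Or.inr ⟨ho, by omega⟩⟩
      intro x hx hx'
      exact ⟨_, ho (q' + p - x) x (by omega) (by omega) (by omega)⟩
  · obtain rfl : q = p + 1 := by omega
    have hc := h.card_gaps hα
    have hpos : 0 < ((gaps n α.im).filter fun x => p ≤ x).card :=
      Finset.card_pos.2 ⟨p, Finset.mem_filter.2 ⟨mem_gaps.2 ⟨by omega, h.not_mem_im, hq⟩, le_rfl⟩⟩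
    rw [← hc] at hpos
    obtain ⟨p', hp'⟩ := Finset.card_pos.1 hpos
    obtain ⟨hg, hle⟩ := Finset.mem_filter.1 hp'
    obtain ⟨hn, hd, hd'⟩ := mem_gaps.1 hg
    refine ⟨p', p' + 1, hle, by omega, by omega, by omega, hd, hd', by omega, ?_⟩
    by_cases hpp : p' % 2 = p % 2
    · exact Or.inl ⟨by omega, hpp⟩
    · exact Or.inr ⟨by omega, by omega⟩

/-- If the block `(p', q')` is translated by an `α` which fixes everything below `p`, its size
is even, and `p < p'`, then some other block beyond `p` can be used to reverse `(p', q')`. -/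
theorem BlockSource.exists_turning {α : PartialInj n} {p q p' q' : ℕ}
    (hb : α.BlockSource p q p' q') (h : α.FixesBelow p)
    (hα : α ∈ IFset n) (hpar : α.PreservesParity) (hlt : p < p') (hq : q ∉ α.im)
    (hin : ∀ x, p < x → x < q → x ∈ α.im)
    (hpp : p' % 2 = p % 2) (hodd : q' % 2 ≠ p' % 2) :
    (∃ k, q' < k ∧ k ≤ n + 1 ∧ k ∉ α.dom ∧ k % 2 = p' % 2) ∨
      ∃ k, p < k ∧ k < p' ∧ k ∉ α.dom ∧ k % 2 = q' % 2 := by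
  classical
  by_contra! hcon
  obtain ⟨hA, hB⟩ := hcon
  have hbl := hb.le
  have hblt := hb.lt
  have hbs := hb.le_succ
  have hbz := hb.size
  have hmem := hb.mem_of_lt
  have hempty : ∀ x, p ≤ x → x ∉ α.dom → (x ≤ p' ∧ x % 2 = p % 2) ∨
      (q' ≤ x ∧ (x ≤ n + 1 → x % 2 ≠ p % 2)) := by
    intro x hx hxd
    have h1 : p < x → x < p' → x % 2 ≠ q' % 2 := fun h1 h2 => hB x h1 h2 hxd
    have h2 : q' < x → x ≤ n + 1 → x % 2 ≠ p' % 2 := fun h1 h2 => hA x h1 h2 hxd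
    have h3 : p' < x → x < q' → False := fun h1 h2 => hxd (hmem x h1 h2)
    rcases lt_trichotomy x p' with h4 | h4 | h4
    · by_cases x = p <;> omega
    · omega
    · by_cases h5 : x < q'
      · exact (h3 h4 h5).elim
      · omega
  obtain ⟨l₀, hl₀, hl₀n, hl₀p, hl₀i⟩ := h.exists_not_mem_im hpar hlt (by omega) hb.left_not_mem hpp
  have hql₀ : q < l₀ := by
    have h1 : ¬ l₀ < q := fun h1 => hl₀i (hin l₀ hl₀ h1)
    have h2 : l₀ ≠ q := by rintro rfl; omega
    omega
  have he : ∃ l, q < l ∧ l ∉ α.im ∧ l % 2 = p % 2 := ⟨l₀, hql₀, hl₀i, hl₀p⟩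
  obtain ⟨hl, hli, hlp⟩ := Nat.find_spec he
  have hle : Nat.find he ≤ l₀ := Nat.find_min' he ⟨hql₀, hl₀i, hl₀p⟩
  have hmin : ∀ x, q < x → x < Nat.find he → x ∉ α.im → x % 2 ≠ p % 2 :=
    fun x h1 h2 h3 h4 => Nat.find_min he h2 ⟨h1, h3, h4⟩
  generalize Nat.find he = l at hl hli hlp hle hmin
  obtain ⟨m, hqm, hml, hmi, hm⟩ := exists_prev_not_mem hl hq
  have hmp : m % 2 ≠ p % 2 := by
    rcases hqm.eq_or_lt with rfl | h1
    · omega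
    · exact hmin m h1 hml hmi
  have hc := h.card_gaps hα
  by_cases hml1 : m + 1 < l
  · obtain ⟨m', l', hs, hl', hmd, hld, ho⟩ :=
      exists_image_block (inv_mem_IFset hα) hml1 hmi hli hm
    change m' ∉ α.dom at hmd
    change l' ∉ α.dom at hld
    change (∀ x z, m < x → x < l → z + m = x + m' → (z, x) ∈ α.graph) ∨
      (∀ x z, m < x → x < l → z + x = l' + m → (z, x) ∈ α.graph) at ho
    obtain ⟨x, hx, hx', hxm⟩ : ∃ x, m < x ∧ x < l ∧ (m' + 1, x) ∈ α.graph := by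
      rcases ho with ho | ho
      · exact ⟨m + 1, by omega, by omega, ho _ _ (by omega) (by omega) (by omega)⟩
      · exact ⟨l - 1, by omega, by omega, ho _ _ (by omega) (by omega) (by omega)⟩
    have hlt' := h.lt_iff hxm
    have em := hempty m' (by omega) hmd
    have el := hempty l' (by omega) hld
    have hdom : ∀ z, m' < z → z < l' → z ∈ α.dom := by
      intro z h1 h2
      rcases ho with ho | ho
      · exact ⟨_, ho (z + m - m') z (by omega) (by omega) (by omega)⟩
      · exact ⟨_, ho (l' + m - z) z (by omega) (by omega) (by omega)⟩
    have n1 : ¬ (m' < p' ∧ p' < l') := fun h1 => hb.left_not_mem (hdom p' h1.1 h1.2)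
    have n2 : ¬ (m' < q' ∧ q' < l') := fun h1 => hb.right_not_mem (hdom q' h1.1 h1.2)
    obtain rfl : m' = p' := by omega
    obtain rfl : l' = q' := by omega
    obtain ⟨y, hy, hy', hym⟩ : ∃ y, p < y ∧ y < q ∧ (m' + 1, y) ∈ α.graph := by
      rcases hb.orientation with ⟨ho, -⟩ | ⟨ho, -⟩
      · exact ⟨p + 1, by omega, by omega, ho _ _ (by omega) (by omega) (by omega)⟩
      · exact ⟨q - 1, by omega, by omega, ho _ _ (by omega) (by omega) (by omega)⟩
    have := α.functional _ hxm _ hym rfl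
    dsimp only at this
    omega
  · obtain rfl : l = m + 1 := by omega
    have hmg : m ∈ (gaps n α.im).filter fun x => p ≤ x :=
      Finset.mem_filter.2 ⟨mem_gaps.2 ⟨by omega, hmi, hli⟩, by omega⟩
    have hsub : ((gaps n α.dom).filter fun x => p ≤ x) ⊆ {p'} := by
      intro x hx
      obtain ⟨hg, hle'⟩ := Finset.mem_filter.1 hx
      obtain ⟨hn, hd, hd'⟩ := mem_gaps.1 hg
      have e1 := hempty x hle' hd
      have e2 := hempty (x + 1) (by omega) hd'
      rw [Finset.mem_singleton]
      omega
    by_cases hpq : q = p + 1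
    · have hpg : p ∈ (gaps n α.im).filter fun x => p ≤ x :=
        Finset.mem_filter.2 ⟨mem_gaps.2 ⟨by omega, h.not_mem_im, hpq ▸ hq⟩, le_rfl⟩
      have h2 : 1 < ((gaps n α.im).filter fun x => p ≤ x).card :=
        Finset.one_lt_card.2 ⟨p, hpg, m, hmg, by omega⟩
      have h3 := Finset.card_le_card hsub
      rw [Finset.card_singleton] at h3
      omega
    · have hpos := Finset.card_pos.2 ⟨m, hmg⟩
      rw [← hc] at hpos
      obtain ⟨x, hx⟩ := Finset.card_pos.1 hpos
      obtain rfl := Finset.mem_singleton.1 (hsub hx)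
      exact (mem_gaps.1 (Finset.mem_filter.1 hx).1).2.2 (hmem (x + 1) (by omega) (by omega))

theorem FixesBelow.reversal_mul_of_le {α : PartialInj n} {p a b : ℕ} (h : α.FixesBelow p)
    (hb : b ≤ n + 1) (hpa : p ≤ a) : (reversal n a b hb * α).FixesBelow p := by
  refine ⟨?_, ?_, ?_⟩
  · rintro ⟨y, z, h1, h2⟩
    dsimp only at h1 h2
    rw [mem_reversal] at h1
    obtain rfl : z = p := by omega
    exact h.not_mem_dom ⟨y, h2⟩
  · rintro ⟨y, z, h1, h2⟩
    exact h.not_mem_im ⟨z, h2⟩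
  · rintro x y ⟨z, h1, h2⟩ hlt
    dsimp only at h1 h2
    rw [mem_reversal] at h1
    have := h.eq_of_lt z y h2
    omega

variable {S : Subsemigroup (PartialInj n)}

theorem mem_of_fixesBelow (hS : ∀ D, pid n D ∈ S)
    (hrev : ∀ i j (hj : j ≤ n + 1), i < j → i % 2 = j % 2 → reversal n i j hj ∈ S) {p : ℕ}
    (hp : p ≤ n + 1) {α : PartialInj n} (hα : α ∈ IFset n) (hpar : α.PreservesParity)
    (h : α.FixesBelow p) : α ∈ S := by
  induction hd : n + 1 - p using Nat.strong_induction_on generalizing p α with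
  | _ d ih =>
  rcases hp.eq_or_lt with rfl | hp
  · refine mem_of_graph_subset hS (hS Set.univ) ?_
    rintro ⟨x, y⟩ hx
    have hb := α.mem_le _ hx
    exact ⟨⟨hb.1, hb.2.1⟩, trivial, (h.eq_of_lt x y hx (Or.inl (Nat.lt_succ_of_le hb.2.1))).symm⟩
  obtain ⟨q, hpq, hqn, hq, hin⟩ := exists_next_not_mem hp α.inv.succ_not_mem_dom
  change q ∉ α.im at hq
  have reflected : ∀ {β : PartialInj n} {p' q' : ℕ}, β ∈ IFset n → β.PreservesParity →
      β.FixesBelow p → q ∉ β.im → p ≤ p' → p' < q' → q' ≤ n + 1 → q + p' = p + q' →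
      p' ∉ β.dom → q' ∉ β.dom → q' % 2 = p % 2 →
      (∀ x z, p < x → x < q → z + x = q' + p → (z, x) ∈ β.graph) → β ∈ S := by
    intro β p' q' hβ hβp hβf hqβ h1 h2 h3 h4 h5 h6 h7 h8
    refine mem_of_reversal_mul_mem hS (hrev p q' h3 (by omega) h7.symm) hβf.not_mem_dom h6 ?_
    exact ih _ (by omega) hqn (mul_mem_IFset (reversal_mem_IFset h3 h7.symm) hβ)
      (PreservesParity.mul (fun x y => reversal_parity h7.symm) hβp)
      (hβf.reversal_mul h3 h1 h2 h4 h5 hqβ h8) rfl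
  obtain ⟨p', q', hb⟩ := h.exists_blockSource hα hpar hpq hqn hq hin
  obtain ⟨h1, h2, h3, h4, h5, h6, h7, ⟨h8, hpp⟩ | ⟨h8, hpp⟩⟩ := id hb
  swap
  · exact reflected hα hpar h hq h1 h2 h3 h4 h5 h6 hpp h8
  rcases h1.eq_or_lt with rfl | hlt
  · obtain rfl : q = q' := by omega
    refine ih _ (by omega) hqn hα hpar ⟨h6, hq, ?_⟩ rfl
    intro x y hx hxq
    have e0 := h.eq_of_lt x y hx
    have e1 := h.lt_iff hx
    have e2 : p < x → x < q → y = x := fun ha hb => α.functional _ hx _ (h8 x x ha hb rfl) rfl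
    have e3 : p < y → y < q → x = y := fun ha hb => α.injOn _ hx _ (h8 y y ha hb rfl) rfl
    have e4 : x ≠ p := by rintro rfl; exact h5 ⟨y, hx⟩
    have e5 : y ≠ p := by rintro rfl; exact h.not_mem_im ⟨x, hx⟩
    omega
  have turn : ∀ {a b : ℕ}, p ≤ a → a ≤ p' → q' ≤ b → b ≤ n + 1 → a ∉ α.dom → b ∉ α.dom →
      a % 2 = b % 2 → α ∈ S := by
    intro a b ha hap hbq hbn had hbd hab
    refine mem_of_reversal_mul_mem hS (hrev a b hbn (by omega) hab) had hbd ?_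
    refine reflected (p' := a + b - q') (q' := a + b - p')
      (mul_mem_IFset (reversal_mem_IFset hbn hab) hα)
      (PreservesParity.mul (fun x y => reversal_parity hab) hpar)
      (h.reversal_mul_of_le hbn ha) ?_ (by omega) (by omega) (by omega) (by omega) ?_ ?_ (by omega)
      ?_
    · rintro ⟨x, z, hx, hz⟩
      exact hq ⟨z, hz⟩
    · rintro ⟨y, z, hx, hz⟩
      dsimp only at hx hz
      rw [mem_reversal] at hx
      obtain rfl : z = q' := by omega
      exact h6 ⟨y, hz⟩
    · rintro ⟨y, z, hx, hz⟩
      dsimp only at hx hz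
      rw [mem_reversal] at hx
      obtain rfl : z = p' := by omega
      exact h5 ⟨y, hz⟩
    · intro x z hx hx' hz
      refine ⟨a + b - z, ?_, h8 _ _ hx hx' ?_⟩
      · dsimp only
        rw [mem_reversal]
        omega
      · dsimp only
        omega
  by_cases hodd : q' % 2 = p' % 2
  · exact turn h1 le_rfl le_rfl h3 h5 h6 hodd.symm
  rcases hb.exists_turning h hα hpar hlt hq hin hpp hodd with
    ⟨k, k1, k2, k3, k4⟩ | ⟨k, k1, k2, k3, k4⟩
  · exact turn h1 le_rfl k1.le k2 h5 k3 k4.symm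
  · exact turn k1.le k2.le le_rfl h3 k3 h6 k4

open Classical in
/-- The points of the image which differ in parity from their preimage. -/
noncomputable def parityDefect (α : PartialInj n) : Finset ℕ :=
  (Finset.range (n + 1)).filter fun y => ∃ x, (x, y) ∈ α.graph ∧ x % 2 ≠ y % 2

theorem mem_parityDefect {α : PartialInj n} {y : ℕ} :
    y ∈ α.parityDefect ↔ ∃ x, (x, y) ∈ α.graph ∧ x % 2 ≠ y % 2 := by
  simp only [parityDefect, Finset.mem_filter, Finset.mem_range, and_iff_right_iff_imp]
  rintro ⟨x, hx, -⟩
  exact Nat.lt_succ_of_le (α.mem_le _ hx).2.2.2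

theorem parityDefect_mul_ssubset {α t : PartialInj n} {a b : ℕ} (hab : (a, b) ∈ α.graph)
    (hne : a % 2 ≠ b % 2)
    (ht : ∀ x z, (x, z) ∈ t.graph → (z = a ∧ x % 2 ≠ a % 2) ∨ (z ≠ a ∧ x % 2 = z % 2)) :
    (t * α).parityDefect ⊂ α.parityDefect := by
  rw [Finset.ssubset_iff_of_subset]
  · refine ⟨b, mem_parityDefect.2 ⟨a, hab, hne⟩, fun hb => ?_⟩
    obtain ⟨x, ⟨z, h1, h2⟩, h3⟩ := mem_parityDefect.1 hb
    have := α.injOn _ h2 _ hab rfl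
    have := ht x z h1
    dsimp only at *
    omega
  · intro y hy
    obtain ⟨x, ⟨z, h1, h2⟩, h3⟩ := mem_parityDefect.1 hy
    dsimp only at h1 h2
    have h4 := ht x z h1
    refine mem_parityDefect.2 ⟨z, h2, ?_⟩
    rcases h4 with ⟨rfl, h4⟩ | ⟨-, h4⟩
    · have : b = y := α.functional _ hab _ h2 rfl
      omega
    · omega

variable {σ₁ σ₂ : PartialInj n}

theorem mem_sigma1 (hσ₁ : σ₁.graph = sigma1Graph n) {x y : ℕ} :
    (x, y) ∈ σ₁.graph ↔ 1 ≤ x ∧ x ≤ n ∧ x ≠ 2 ∧ ((x = 1 ∧ y = n) ∨ (x ≠ 1 ∧ y + 2 = x)) := by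
  rw [hσ₁]
  change (1 ≤ x ∧ x ≤ n ∧ x ≠ 2 ∧ y = if x = 1 then n else x - 2) ↔ _
  split_ifs <;> omega

theorem mem_sigma2 (hσ₂ : σ₂.graph = sigma2Graph n) {x y : ℕ} :
    (x, y) ∈ σ₂.graph ↔
      1 ≤ x ∧ x ≤ n ∧ x ≠ n - 1 ∧ ((x = n ∧ y = 1) ∨ (x ≠ n ∧ y = x + 2)) := by
  rw [hσ₂]
  change (1 ≤ x ∧ x ≤ n ∧ x ≠ n - 1 ∧ y = if x = n then 1 else x + 2) ↔ _
  split_ifs <;> omega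

theorem sigma1_mem_IFset (hn : n % 2 = 0) (hσ₁ : σ₁.graph = sigma1Graph n) : σ₁ ∈ IFset n := by
  rw [mem_IFset_iff]
  intro x y x' y' h h'
  rw [mem_sigma1 hσ₁] at h h'
  simp only [fenceLt_iff]
  omega

theorem sigma2_mem_IFset (hn : n % 2 = 0) (hσ₂ : σ₂.graph = sigma2Graph n) : σ₂ ∈ IFset n := by
  rw [mem_IFset_iff]
  intro x y x' y' h h'
  rw [mem_sigma2 hσ₂] at h h'
  simp only [fenceLt_iff]
  omega

theorem mem_of_reversals_of_shifts (hn : n % 2 = 0) (hn0 : 0 < n) (hS : ∀ D, pid n D ∈ S)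
    (hrev : ∀ i j (hj : j ≤ n + 1), i < j → i % 2 = j % 2 → reversal n i j hj ∈ S)
    (hσ₁ : σ₁.graph = sigma1Graph n) (hσ₂ : σ₂.graph = sigma2Graph n)
    (h₁ : σ₁ ∈ S) (h₂ : σ₂ ∈ S) {α : PartialInj n} (hα : α ∈ IFset n) : α ∈ S := by
  induction hd : α.parityDefect.card using Nat.strong_induction_on generalizing α with
  | _ d ih =>
  by_cases hpar : α.PreservesParity
  · refine mem_of_fixesBelow hS hrev (Nat.zero_le _) hα hpar
      ⟨α.zero_not_mem_dom, α.inv.zero_not_mem_dom, fun x y _ h => ?_⟩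
    omega
  obtain ⟨a, b, hab, hne⟩ : ∃ a b, (a, b) ∈ α.graph ∧ a % 2 ≠ b % 2 := by
    simpa [PreservesParity] using hpar
  have hab' := α.mem_le _ hab
  dsimp only at hab'
  have hsucc : a + 1 ∉ α.dom := by
    rintro ⟨y, hy⟩
    exact hne (adjacent_image hα hab hy).2
  have hpred : a - 1 ∉ α.dom := by
    rintro ⟨y, hy⟩
    have := adjacent_image hα hy (z := b) (by rwa [Nat.sub_add_cancel hab'.1])
    omega
  have reduce : ∀ {s t : PartialInj n}, s ∈ S → t ∈ IFset n →
      (∀ x y, (x, y) ∈ α.graph → ∃ w, (x, w) ∈ s.graph ∧ (w, x) ∈ t.graph) →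
      (∀ x z, (x, z) ∈ t.graph → (z = a ∧ x % 2 ≠ a % 2) ∨ (z ≠ a ∧ x % 2 = z % 2)) → α ∈ S := by
    intro s t hs ht hst hta
    have hlt := Finset.card_lt_card (parityDefect_mul_ssubset hab hne hta)
    rw [hd] at hlt
    refine mem_of_graph_subset hS (S.mul_mem hs (ih _ hlt (mul_mem_IFset ht hα) rfl)) ?_
    rintro ⟨x, y⟩ hx
    obtain ⟨w, h1, h2⟩ := hst x y hx
    exact ⟨w, h1, x, h2, hx⟩
  have hxne : ∀ x y, (x, y) ∈ α.graph → 1 ≤ x ∧ x ≤ n ∧ x ≠ a - 1 ∧ x ≠ a + 1 := by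
    intro x y hx
    have hb := α.mem_le _ hx
    refine ⟨hb.1, hb.2.1, ?_, ?_⟩
    · rintro rfl
      exact hpred ⟨_, hx⟩
    · rintro rfl
      exact hsucc ⟨_, hx⟩
  by_cases ha : a % 2 = 0
  · have hp : (a - 1) % 2 = (n + 1) % 2 := by omega
    refine reduce (S.mul_mem (hrev (a - 1) (n + 1) le_rfl (by omega) hp) h₂)
      (mul_mem_IFset (sigma1_mem_IFset hn hσ₁) (reversal_mem_IFset le_rfl hp)) ?_ ?_
    · intro x y hx
      have hb := hxne x y hx
      obtain ⟨u, hu⟩ : ∃ u, (x, u) ∈ (reversal n (a - 1) (n + 1) le_rfl).graph := by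
        by_cases hxa : a ≤ x
        · exact ⟨a + n - x, by rw [mem_reversal]; omega⟩
        · exact ⟨x, by rw [mem_reversal]; omega⟩
      have hu' : (u, x) ∈ (reversal n (a - 1) (n + 1) le_rfl).graph := by
        rw [mem_reversal] at hu ⊢
        omega
      have hub := mem_reversal.1 hu
      obtain ⟨w, hw⟩ : ∃ w, (u, w) ∈ σ₂.graph := by
        by_cases hun : u = n
        · exact ⟨1, by rw [mem_sigma2 hσ₂]; omega⟩
        · exact ⟨u + 2, by rw [mem_sigma2 hσ₂]; omega⟩
      refine ⟨w, ⟨u, hu, hw⟩, u, ?_, hu'⟩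
      dsimp only
      rw [mem_sigma2 hσ₂] at hw
      rw [mem_sigma1 hσ₁]
      omega
    · rintro x z ⟨u, h1, h2⟩
      dsimp only at h1 h2
      rw [mem_sigma1 hσ₁] at h1
      rw [mem_reversal] at h2
      omega
  · have hp : 0 % 2 = (a + 1) % 2 := by omega
    have hj : a + 1 ≤ n + 1 := by omega
    refine reduce (S.mul_mem (hrev 0 (a + 1) hj (by omega) hp) h₁)
      (mul_mem_IFset (sigma2_mem_IFset hn hσ₂) (reversal_mem_IFset hj hp)) ?_ ?_
    · intro x y hx
      have hb := hxne x y hx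
      obtain ⟨u, hu⟩ : ∃ u, (x, u) ∈ (reversal n 0 (a + 1) hj).graph := by
        by_cases hxa : x ≤ a
        · exact ⟨a + 1 - x, by rw [mem_reversal]; omega⟩
        · exact ⟨x, by rw [mem_reversal]; omega⟩
      have hu' : (u, x) ∈ (reversal n 0 (a + 1) hj).graph := by
        rw [mem_reversal] at hu ⊢
        omega
      have hub := mem_reversal.1 hu
      obtain ⟨w, hw⟩ : ∃ w, (u, w) ∈ σ₁.graph := by
        by_cases hun : u = 1
        · exact ⟨n, by rw [mem_sigma1 hσ₁]; omega⟩
        · exact ⟨u - 2, by rw [mem_sigma1 hσ₁]; omega⟩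
      refine ⟨w, ⟨u, hu, hw⟩, u, ?_, hu'⟩
      dsimp only
      rw [mem_sigma1 hσ₁] at hw
      rw [mem_sigma2 hσ₂]
      omega
    · rintro x z ⟨u, h1, h2⟩
      dsimp only at h1 h2
      rw [mem_sigma2 hσ₂] at h1
      rw [mem_reversal] at h2
      omega

/-- All partial identities are generated by those of corank at most one. -/
theorem pid_mem_of_pid_ne_mem (h1 : pid n (Set.Icc 1 n) ∈ S) (h : ∀ i, pid n {x | x ≠ i} ∈ S)
    (D : Set ℕ) : pid n D ∈ S := by
  have key : ∀ k, pid n {x | x ∈ D ∨ k < x} ∈ S := by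
    intro k
    induction k with
    | zero =>
      convert h1 using 1
      apply ext'
      ext ⟨x, y⟩
      simp only [mem_pid, Set.mem_ofPred_eq, Set.mem_Icc]
      refine and_congr_right fun hx => ?_
      simp [hx, show 0 < x from hx.1]
    | succ k ih =>
      by_cases hk : k + 1 ∈ D
      · convert ih using 2
        ext x
        simp only [Set.mem_ofPred_eq]
        by_cases hx : x = k + 1
        · simp [hx, hk]
        · rw [show k + 1 < x ↔ k < x by omega]
      · convert S.mul_mem ih (h (k + 1)) using 1
        apply ext'
        ext ⟨x, y⟩
        simp only [mul_graph, mem_pid, Set.mem_ofPred_eq]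
        constructor
        · rintro ⟨hb, hx, rfl⟩
          refine ⟨y, ⟨hb, hx.imp_right (by omega), rfl⟩, hb, ?_, rfl⟩
          rintro rfl
          exact hx.elim hk (lt_irrefl _)
        · rintro ⟨z, ⟨hb, hx, rfl⟩, -, hne, rfl⟩
          exact ⟨hb, hx.imp_right (by omega), rfl⟩
  convert key n using 1
  apply ext'
  ext ⟨x, y⟩
  simp only [mem_pid, Set.mem_ofPred_eq]
  refine and_congr_right fun hx => ?_
  simp [Nat.not_lt.2 hx.2]

theorem pid_ne_eq_mul {s t : PartialInj n} {i : ℕ} (hi : i ∉ s.dom)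
    (h : ∀ x, 1 ≤ x → x ≤ n → x ≠ i → ∃ w, (x, w) ∈ s.graph ∧ (w, x) ∈ t.graph) :
    pid n {x | x ≠ i} = s * t := by
  apply ext'
  ext ⟨x, y⟩
  rw [mem_pid]
  constructor
  · rintro ⟨hb, hx, rfl⟩
    exact h y hb.1 hb.2 hx
  · rintro ⟨z, h1, h2⟩
    have hb := s.mem_le _ h1
    have hx : x ≠ i := by rintro rfl; exact hi ⟨_, h1⟩
    refine ⟨⟨hb.1, hb.2.1⟩, hx, ?_⟩
    obtain ⟨w, h3, h4⟩ := h x hb.1 hb.2.1 hx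
    have e : z = w := s.functional _ h1 _ h3 rfl
    subst e
    exact t.functional _ h2 _ h4 rfl

theorem eq_reversal_of_gammaGraph {γ : PartialInj n} {i : ℕ} (hi : i ≤ n + 1)
    (h : γ.graph = gammaGraph n i) : γ = reversal n 0 i hi := by
  apply ext'
  ext ⟨x, y⟩
  rw [mem_reversal, h]
  change (1 ≤ x ∧ x ≤ n ∧ x ≠ i ∧ y = if x < i then i - x else x) ↔ _
  split_ifs <;> omega

theorem eq_reversal_of_deltaGraph {δ : PartialInj n} {i : ℕ}
    (h : δ.graph = deltaGraph n i) : δ = reversal n i (n + 1) le_rfl := by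
  apply ext'
  ext ⟨x, y⟩
  rw [mem_reversal, h]
  change (1 ≤ x ∧ x ≤ n ∧ x ≠ i ∧ y = if x < i then x else n + i + 1 - x) ↔ _
  split_ifs <;> omega

theorem pid_ne_eq_reversal_mul_reversal {i j k : ℕ} (hj : j ≤ n + 1) (hk : k = i ∨ k = j)
    (h : ∀ x, 1 ≤ x → x ≤ n → x ≠ k → x ≠ i ∧ x ≠ j) :
    pid n {x | x ≠ k} = reversal n i j hj * reversal n i j hj := by
  refine pid_ne_eq_mul ?_ fun x h1 h2 h3 => ?_
  · rintro ⟨y, hy⟩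
    rw [mem_reversal] at hy
    omega
  · have := h x h1 h2 h3
    by_cases hx : i < x ∧ x < j
    · exact ⟨i + j - x, by rw [mem_reversal]; omega, by rw [mem_reversal]; omega⟩
    · exact ⟨x, by rw [mem_reversal]; omega, by rw [mem_reversal]; omega⟩

/-- A subsemigroup with all reversals of initial and of final segments has all reversals. -/
theorem reversal_mem (hn : n % 2 = 0) (hS : ∀ D, pid n D ∈ S)
    (h0 : ∀ j (hj : j ≤ n + 1), 0 < j → j % 2 = 0 → reversal n 0 j hj ∈ S)
    (h1 : ∀ i, i < n + 1 → i % 2 = 1 → reversal n i (n + 1) le_rfl ∈ S)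
    (i j : ℕ) (hj : j ≤ n + 1) (hij : i < j) (hp : i % 2 = j % 2) : reversal n i j hj ∈ S := by
  by_cases hi : i % 2 = 0
  · refine mem_of_graph_subset hS (S.mul_mem (S.mul_mem (h0 j hj (by omega) (by omega))
      (h0 (j - i) (by omega) (by omega) (by omega))) (h0 j hj (by omega) (by omega))) ?_
    rintro ⟨x, y⟩ hx
    rw [mem_reversal] at hx
    have e1 : ∀ u v, (u, v) ∈ (reversal n 0 j hj).graph ↔ _ := fun u v => mem_reversal
    have e2 : ∀ u v, (u, v) ∈ (reversal n 0 (j - i) (by omega)).graph ↔ _ :=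
      fun u v => mem_reversal
    simp only [mul_graph, Set.mem_ofPred_eq, e1, e2]
    by_cases hxj : x < j
    · by_cases hxi : i < x
      · exact ⟨x - i, ⟨j - x, by omega, by omega⟩, by omega⟩
      · exact ⟨j - x, ⟨j - x, by omega, by omega⟩, by omega⟩
    · exact ⟨x, ⟨x, by omega, by omega⟩, by omega⟩
  · refine mem_of_graph_subset hS (S.mul_mem (S.mul_mem (h1 i (by omega) (by omega))
      (h1 (n + 1 + i - j) (by omega) (by omega))) (h1 i (by omega) (by omega))) ?_
    rintro ⟨x, y⟩ hx
    rw [mem_reversal] at hx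
    have e1 : ∀ a u v, (u, v) ∈ (reversal n a (n + 1) le_rfl).graph ↔ _ :=
      fun a u v => mem_reversal
    simp only [mul_graph, Set.mem_ofPred_eq, e1]
    by_cases hxi : i < x
    · by_cases hxj : x < j
      · exact ⟨n + 1 + x - j, ⟨n + 1 + i - x, by omega, by omega⟩, by omega⟩
      · exact ⟨n + 1 + i - x, ⟨n + 1 + i - x, by omega, by omega⟩, by omega⟩
    · exact ⟨x, ⟨x, by omega, by omega⟩, by omega⟩

end PartialInj

/-- Theorem 2: for even `n`, `IF_n = ⟨G⟩`. -/
theorem theo2 (n : ℕ) (hn : Even n) (hn0 : 0 < n)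
    (σ₁ σ₂ : PartialInj n) (γ δ : ℕ → PartialInj n)
    (hσ₁ : σ₁.graph = sigma1Graph n) (hσ₂ : σ₂.graph = sigma2Graph n)
    (hγ : ∀ i, Even i → 4 ≤ i → i ≤ n → (γ i).graph = gammaGraph n i)
    (hδ : ∀ i, Odd i → i ≤ n - 3 → (δ i).graph = deltaGraph n i) :
    IFset n = ↑(Subsemigroup.closure (Gset n σ₁ σ₂ γ δ)) := by
  have hn2 : n % 2 = 0 := Nat.even_iff.1 hn
  have hγ' : ∀ i (hi : i ≤ n), Even i → 4 ≤ i → γ i = reversal n 0 i (by omega) :=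
    fun i hi he h4 => eq_reversal_of_gammaGraph _ (hγ i he h4 hi)
  have hδ' : ∀ i, Odd i → i ≤ n - 3 → δ i = reversal n i (n + 1) le_rfl :=
    fun i ho hi => eq_reversal_of_deltaGraph (hδ i ho hi)
  apply Set.Subset.antisymm
  · set S := Subsemigroup.closure (Gset n σ₁ σ₂ γ δ) with hSdef
    have hid : pid n (Set.Icc 1 n) ∈ S :=
      Subsemigroup.subset_closure (Or.inl (Or.inl (Or.inl rfl)))
    have h₁ : σ₁ ∈ S := Subsemigroup.subset_closure (Or.inl (Or.inl (Or.inr (Or.inl rfl))))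
    have h₂ : σ₂ ∈ S := Subsemigroup.subset_closure (Or.inl (Or.inl (Or.inr (Or.inr rfl))))
    have hγS : ∀ i (hi : i ≤ n), Even i → 4 ≤ i → reversal n 0 i (by omega) ∈ S :=
      fun i hi he h4 => hγ' i hi he h4 ▸
        Subsemigroup.subset_closure (Or.inl (Or.inr ⟨i, he, h4, hi, rfl⟩))
    have hδS : ∀ i, Odd i → i ≤ n - 3 → reversal n i (n + 1) le_rfl ∈ S :=
      fun i ho hi => hδ' i ho hi ▸ Subsemigroup.subset_closure (Or.inr ⟨i, ho, hi, rfl⟩)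
    have hS : ∀ D, pid n D ∈ S := by
      refine pid_mem_of_pid_ne_mem hid fun i => ?_
      by_cases hi : 1 ≤ i ∧ i ≤ n
      swap
      · convert hid using 1
        apply ext'
        ext ⟨x, y⟩
        simp only [mem_pid, Set.mem_ofPred_eq, Set.mem_Icc]
        omega
      by_cases he : i % 2 = 0
      · by_cases h2 : i = 2
        · subst h2
          rw [pid_ne_eq_mul (s := σ₁) (t := σ₂)]
          · exact S.mul_mem h₁ h₂
          · rintro ⟨y, hy⟩
            rw [mem_sigma1 hσ₁] at hy
            omega
          · intro x hx hx' hne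
            simp only [mem_sigma1 hσ₁, mem_sigma2 hσ₂]
            by_cases hx1 : x = 1
            · exact ⟨n, by omega, by omega⟩
            · exact ⟨x - 2, by omega, by omega⟩
        · have := hγS i hi.2 (Nat.even_iff.2 he) (by omega)
          rw [pid_ne_eq_reversal_mul_reversal (i := 0) (j := i) (by omega) (Or.inr rfl)
            (by omega)]
          exact S.mul_mem this this
      · by_cases h2 : i = n - 1
        · subst h2
          rw [pid_ne_eq_mul (s := σ₂) (t := σ₁)]
          · exact S.mul_mem h₂ h₁
          · rintro ⟨y, hy⟩
            rw [mem_sigma2 hσ₂] at hy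
            omega
          · intro x hx hx' hne
            simp only [mem_sigma1 hσ₁, mem_sigma2 hσ₂]
            by_cases hx1 : x = n
            · exact ⟨1, by omega, by omega⟩
            · exact ⟨x + 2, by omega, by omega⟩
        · have := hδS i (Nat.odd_iff.2 (by omega)) (by omega)
          rw [pid_ne_eq_reversal_mul_reversal (i := i) (j := n + 1) le_rfl (Or.inl rfl)
            (by omega)]
          exact S.mul_mem this this
    have trivial_reversal : ∀ i j (hj : j ≤ n + 1), j = i + 2 → reversal n i j hj ∈ S := by
      rintro i j hj rfl
      refine mem_of_graph_subset hS hid ?_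
      rintro ⟨x, y⟩ hx
      rw [mem_reversal] at hx
      rw [mem_pid, Set.mem_Icc]
      omega
    intro α hα
    refine mem_of_reversals_of_shifts hn2 hn0 hS (reversal_mem hn2 hS ?_ ?_) hσ₁ hσ₂ h₁ h₂ hα
    · intro j hj hj0 he
      by_cases h2 : j = 2
      · exact trivial_reversal 0 j hj h2
      · exact hγS j (by omega) (Nat.even_iff.2 he) (by omega)
    · intro i hi ho
      by_cases h2 : n + 1 = i + 2
      · exact trivial_reversal i _ le_rfl h2
      · exact hδS i (Nat.odd_iff.2 ho) (by omega)
  · intro α hα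
    induction hα using Subsemigroup.closure_induction with
    | mem g hg =>
      rcases hg with ((rfl | rfl | rfl) | ⟨i, he, h4, hi, rfl⟩) | ⟨i, ho, hi, rfl⟩
      · rw [mem_IFset_iff]
        intro x y x' y' h h'
        rw [(mem_pid.1 h).2.2, (mem_pid.1 h').2.2]
      · exact sigma1_mem_IFset hn2 hσ₁
      · exact sigma2_mem_IFset hn2 hσ₂
      · rw [hγ' i hi he h4]
        rw [Nat.even_iff] at he
        exact reversal_mem_IFset _ (by omega)
      · rw [hδ' i ho hi]
        rw [Nat.odd_iff] at ho
        exact reversal_mem_IFset _ (by omega)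
    | mul x y _ _ hx hy => exact mul_mem_IFset hx hy

end FencePaper
end
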